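/- Let m_1 ≥ m_2 ≥ … ≥ m_s ≥ 0 be integers with m_1 + m_2 ≥ n, let τ = max{ i : m_1 + m_i ≥ n } and v = Σ_{i=2}^{τ} (m_1 + m_i − n + 1). Assume 2m_1 − n + 2 ≤ v ≤ m_1, τ = 3, and either (s ≥ 4 and 2n ≥ m_1 + m_2 + m_3 + m_4 + 2) or s = 3. Then there exist subspaces W_1, …, W_s of ℂ^{n+1} with dim W_i = m_i + 1 such that dim Q(W_1,…,W_s) = max{ C(n+2,2) − Σ_{i=1}^s C(m_i+2,2) + Σ_{1 ≤ i < j ≤ 3} C(m_i + m_j − n + 2, 2), 0 }; that is, for a generic configuration of linear spaces Λ of weight vector (m_1,…,m_s) in P^n, dim (I_Λ)_2 equals this maximum. -/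

import Mathlib

/-- The vector space `Q(W_1, …, W_s)` of quadratic forms on `ℂ^{n+1}` vanishing identically
on each of the subspaces `W 1, …, W s`. -/
def quadVanishing (n s : ℕ) (W : ℕ → Submodule ℂ (Fin (n + 1) → ℂ)) :
    Submodule ℂ (QuadraticForm ℂ (Fin (n + 1) → ℂ)) where
  carrier := {q | ∀ i ∈ Finset.Icc 1 s, ∀ x ∈ W i, q x = 0}
  add_mem' := by
    intro a b ha hb i hi v hv
    simp [ha i hi v hv, hb i hi v hv]
  zero_mem' := by intro i hi v hv; simp
  smul_mem' := by
    intro c a ha i hi v hv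
    simp [ha i hi v hv]


open scoped IntermediateField.algebraAdjoinAdjoin in
theorem formallySmooth_adjoin_basis {ι : Type} (v : ι → ℂ) (hv : IsTranscendenceBasis ℚ v) :
    Algebra.FormallySmooth (Algebra.adjoin ℚ (Set.range v)) ℂ := by
  have h1 : Algebra.FormallySmooth (Algebra.adjoin ℚ (Set.range v))
      (IntermediateField.adjoin ℚ (Set.range v)) :=
    .of_isLocalization (nonZeroDivisors _)
  have := hv.isAlgebraic_field
  have h2 : Algebra.FormallyEtale (IntermediateField.adjoin ℚ (Set.range v)) ℂ :=
    Algebra.FormallyEtale.of_isSeparable _ ℂ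
  exact .comp _ (IntermediateField.adjoin ℚ (Set.range v)) _

theorem exists_der_of_smooth {R : Type} [CommRing R] [Algebra R ℂ] [Algebra.FormallySmooth R ℂ]
    (g : R →+* TrivSqZeroExt ℂ ℂ) (hg : ∀ r, (g r).fst = algebraMap R ℂ r) :
    ∃ δ : ℂ →+ ℂ, (∀ x y, δ (x * y) = x * δ y + δ x * y) ∧
      ∀ r, δ (algebraMap R ℂ r) = (g r).snd := by
  let _ : Algebra R (TrivSqZeroExt ℂ ℂ) := g.toAlgebra
  let p : TrivSqZeroExt ℂ ℂ →ₐ[R] ℂ :=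
    { (TrivSqZeroExt.fstHom ℂ ℂ ℂ : TrivSqZeroExt ℂ ℂ →+* ℂ) with
      commutes' := hg }
  have hp : ∀ x, p x = x.fst := fun x => rfl
  have hsurj : Function.Surjective p := fun x => ⟨TrivSqZeroExt.inl x, by simp [hp]⟩
  have hnil : IsNilpotent (RingHom.ker (p : TrivSqZeroExt ℂ ℂ →+* ℂ)) := by
    refine ⟨2, ?_⟩
    refine (pow_two (M := Ideal (TrivSqZeroExt ℂ ℂ)) _).trans ?_
    rw [Ideal.zero_eq_bot, eq_bot_iff, Ideal.mul_le]
    intro x hx y hy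
    have hx' : x.fst = 0 := hx
    have hy' : y.fst = 0 := hy
    simp only [Ideal.mem_bot]
    ext <;> simp [hx', hy']
  let L := Algebra.FormallySmooth.liftOfSurjective (AlgHom.id R ℂ) p hsurj hnil
  have hL : ∀ x, (L x).fst = x := fun x =>
    Algebra.FormallySmooth.liftOfSurjective_apply (AlgHom.id R ℂ) p hsurj hnil x
  refine ⟨⟨⟨fun x => (L x).snd, by simp⟩, by simp⟩, ?_, ?_⟩
  · intro x y
    simp [hL]
  · intro r
    have : L (algebraMap R ℂ r) = g r := L.commutes r
    simp [this]

theorem exists_der_of_basis {ι : Type} (v : ι → ℂ) (hv : IsTranscendenceBasis ℚ v) (s : ι → ℂ) :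
    ∃ δ : ℂ →+ ℂ, (∀ x y, δ (x * y) = x * δ y + δ x * y) ∧ ∀ i, δ (v i) = s i := by
  have := formallySmooth_adjoin_basis v hv
  let e := hv.1.aevalEquiv
  let f : MvPolynomial ι ℚ →ₐ[ℚ] TrivSqZeroExt ℂ ℂ :=
    MvPolynomial.aeval (fun i => TrivSqZeroExt.inl (v i) + TrivSqZeroExt.inr (s i))
  obtain ⟨δ, h1, h2⟩ := exists_der_of_smooth
    (R := Algebra.adjoin ℚ (Set.range v)) (f.comp (e.symm : _ →ₐ[ℚ] _) : _ →ₐ[ℚ] _).toRingHom (by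
      intro r
      obtain ⟨q, rfl⟩ := e.surjective r
      have h3 : ((TrivSqZeroExt.fstHom ℚ ℂ ℂ).comp f) = MvPolynomial.aeval v := by
        ext i; simp [f]
      have h4 := DFunLike.congr_fun h3 q
      simp at h4 ⊢
      rw [h4]
      simp [e, Algebra.algebraMap_eq_smul_one, Subalgebra.smul_def])
  refine ⟨δ, h1, fun i => ?_⟩
  have h3 : algebraMap (Algebra.adjoin ℚ (Set.range v)) ℂ (e (MvPolynomial.X i)) = v i := by
    simp [e, Algebra.algebraMap_eq_smul_one, Subalgebra.smul_def]
  rw [← h3, h2]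
  simp [f]

/-- An infinite supply of complex numbers whose derivatives can be freely prescribed. -/
theorem exists_generic (ι : Type) [Finite ι] : ∃ v : ι → ℂ, ∀ s : ι → ℂ,
    ∃ δ : ℂ →+ ℂ, (∀ x y, δ (x * y) = x * δ y + δ x * y) ∧ ∀ i, δ (v i) = s i := by
  obtain ⟨S, hS⟩ := exists_isTranscendenceBasis ℚ ℂ
  have hc := IsAlgClosed.cardinal_eq_cardinal_transcendence_basis_of_aleph0_lt' _ hS
    (by simp) (by simpa using Cardinal.aleph0_lt_continuum)
  have : Infinite S := by
    rw [Cardinal.infinite_iff, ← hc]; simpa using Cardinal.aleph0_lt_continuum.le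
  obtain ⟨n, ⟨e⟩⟩ := Finite.exists_equiv_fin ι
  let f : ι → S := fun i => Infinite.natEmbedding S (e i)
  have hf : Function.Injective f := fun i j h => by
    exact e.injective (Fin.ext (by simpa [f] using h))
  refine ⟨fun i => f i, fun s => ?_⟩
  obtain ⟨δ, h1, h2⟩ := exists_der_of_basis _ hS (Function.extend f s 0)
  exact ⟨δ, h1, fun i => by rw [h2 (f i), hf.extend_apply]⟩

section Part1

open Matrix

/-- The entries of the matrices `I j`, `T j` are differentially generic. -/
def DiffGen {J : Type} {h : ℕ} {d : J → ℕ} (I T : ∀ j, Matrix (Fin h) (Fin (d j)) ℂ) : Prop :=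
  ∀ I' T' : ∀ j, Matrix (Fin h) (Fin (d j)) ℂ,
    ∃ δ : ℂ →+ ℂ, (∀ x y, δ (x * y) = x * δ y + δ x * y) ∧
      (∀ j, (I j).map δ = I' j) ∧ (∀ j, (T j).map δ = T' j)

theorem exists_diffGen (J : Type) [Finite J] (h : ℕ) (d : J → ℕ) :
    ∃ I T : ∀ j, Matrix (Fin h) (Fin (d j)) ℂ, DiffGen I T := by
  obtain ⟨v, hv⟩ := exists_generic (Bool × (Σ j : J, Fin h × Fin (d j)))
  refine ⟨fun j a b => v (true, ⟨j, a, b⟩), fun j a b => v (false, ⟨j, a, b⟩), ?_⟩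
  intro I' T'
  obtain ⟨δ, h1, h2⟩ := hv (fun p => if p.1 then I' p.2.1 p.2.2.1 p.2.2.2
    else T' p.2.1 p.2.2.1 p.2.2.2)
  refine ⟨δ, h1, fun j => ?_, fun j => ?_⟩
  · ext a b; exact (h2 (true, ⟨j, a, b⟩)).trans (by simp)
  · ext a b; exact (h2 (false, ⟨j, a, b⟩)).trans (by simp)

/-- The linear map `Y → V / Y` induced by a derivation. -/
def derQ {ι : Type} (δ : ℂ →+ ℂ) (hδ : ∀ x y, δ (x * y) = x * δ y + δ x * y)
    (Y : Submodule ℂ (ι → ℂ)) : Y →ₗ[ℂ] ((ι → ℂ) ⧸ Y) where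
  toFun x := Y.mkQ (fun i => δ (x.1 i))
  map_add' x y := by
    rw [← map_add]; congr 1; ext i; simp
  map_smul' c x := by
    simp only [RingHom.id_apply]
    rw [← map_smul, ← sub_eq_zero, ← map_sub]
    rw [Submodule.mkQ_apply, Submodule.Quotient.mk_eq_zero]
    convert Y.smul_mem (δ c) x.2 using 1
    ext i; simp [hδ]

theorem der_mulVec {m n : Type} [Fintype n] (δ : ℂ →+ ℂ)
    (hδ : ∀ x y, δ (x * y) = x * δ y + δ x * y) (M : Matrix m n ℂ) (x : n → ℂ) :
    (fun i => δ ((M *ᵥ x) i)) = M *ᵥ (fun i => δ (x i)) + (M.map δ) *ᵥ x := by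
  ext i
  simp [Matrix.mulVec, dotProduct, hδ, Finset.sum_add_distrib]

theorem der_mul {m n p : Type} [Fintype n] (δ : ℂ →+ ℂ)
    (hδ : ∀ x y, δ (x * y) = x * δ y + δ x * y) (M : Matrix m n ℂ) (N : Matrix n p ℂ) :
    (M * N).map δ = M * N.map δ + M.map δ * N := by
  ext i
  simp [Matrix.mul_apply, hδ, Finset.sum_add_distrib]

variable {J : Type} [Fintype J] {h : ℕ} {d : J → ℕ}
    (I T : ∀ j, Matrix (Fin h) (Fin (d j)) ℂ)

/-- The subspace of `D_j` mapped into `Y` by both maps. -/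
def subY (Y : Submodule ℂ (Fin h → ℂ)) (j : J) : Submodule ℂ (Fin (d j) → ℂ) :=
  Y.comap (I j).mulVecLin ⊓ Y.comap (T j).mulVecLin

theorem mem_subY (Y : Submodule ℂ (Fin h → ℂ)) (j : J) (x) :
    x ∈ subY I T Y j ↔ I j *ᵥ x ∈ Y ∧ T j *ᵥ x ∈ Y := Iff.rfl

/-- The restriction of `(I, T)` to the subspace. -/
def resI (Y : Submodule ℂ (Fin h → ℂ)) (j : J) : subY I T Y j →ₗ[ℂ] Y :=
  (I j).mulVecLin.restrict (fun _ hx => hx.1)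

/-- The restriction of `(I, T)` to the subspace. -/
def resT (Y : Submodule ℂ (Fin h → ℂ)) (j : J) : subY I T Y j →ₗ[ℂ] Y :=
  (T j).mulVecLin.restrict (fun _ hx => hx.2)

/-- Quotient maps. -/
def quoI (Y : Submodule ℂ (Fin h → ℂ)) (j : J) :
    ((Fin (d j) → ℂ) ⧸ subY I T Y j) →ₗ[ℂ] ((Fin h → ℂ) ⧸ Y) :=
  Submodule.mapQ _ _ (I j).mulVecLin (fun _ hx => hx.1)

/-- Quotient maps. -/
def quoT (Y : Submodule ℂ (Fin h → ℂ)) (j : J) :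
    ((Fin (d j) → ℂ) ⧸ subY I T Y j) →ₗ[ℂ] ((Fin h → ℂ) ⧸ Y) :=
  Submodule.mapQ _ _ (T j).mulVecLin (fun _ hx => hx.2)

/-- The tangent map. -/
def tang (Y : Submodule ℂ (Fin h → ℂ)) :
    ((Y →ₗ[ℂ] ((Fin h → ℂ) ⧸ Y)) ×
      (∀ j, subY I T Y j →ₗ[ℂ] ((Fin (d j) → ℂ) ⧸ subY I T Y j))) →ₗ[ℂ]
    (∀ j, (subY I T Y j →ₗ[ℂ] ((Fin h → ℂ) ⧸ Y)) × (subY I T Y j →ₗ[ℂ] ((Fin h → ℂ) ⧸ Y))) where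
  toFun p := fun j => (p.1 ∘ₗ resI I T Y j - quoI I T Y j ∘ₗ p.2 j,
    p.1 ∘ₗ resT I T Y j - quoT I T Y j ∘ₗ p.2 j)
  map_add' p q := by
    ext j x <;> simp <;> abel
  map_smul' c p := by
    ext j x <;> simp [smul_sub]

theorem tang_der (Y : Submodule ℂ (Fin h → ℂ)) (δ : ℂ →+ ℂ)
    (hδ : ∀ x y, δ (x * y) = x * δ y + δ x * y) (j : J) :
    tang I T Y (derQ δ hδ Y, fun j => derQ δ hδ (subY I T Y j)) j =
      (Y.mkQ ∘ₗ ((I j).map δ).mulVecLin ∘ₗ (subY I T Y j).subtype,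
       Y.mkQ ∘ₗ ((T j).map δ).mulVecLin ∘ₗ (subY I T Y j).subtype) := by
  refine Prod.ext ?_ ?_
  · refine LinearMap.ext fun x => ?_
    change Y.mkQ (fun i => δ ((I j *ᵥ x.1) i)) - Y.mkQ (I j *ᵥ (fun i => δ (x.1 i))) = 
      Y.mkQ (((I j).map δ) *ᵥ x.1)
    rw [der_mulVec δ hδ, map_add, add_sub_cancel_left]
  · refine LinearMap.ext fun x => ?_
    change Y.mkQ (fun i => δ ((T j *ᵥ x.1) i)) - Y.mkQ (T j *ᵥ (fun i => δ (x.1 i))) = 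
      Y.mkQ (((T j).map δ) *ᵥ x.1)
    rw [der_mulVec δ hδ, map_add, add_sub_cancel_left]

theorem exists_mat {d : ℕ} (Y : Submodule ℂ (Fin h → ℂ)) (Z : Submodule ℂ (Fin d → ℂ))
    (ψ : Z →ₗ[ℂ] ((Fin h → ℂ) ⧸ Y)) :
    ∃ M : Matrix (Fin h) (Fin d) ℂ, Y.mkQ ∘ₗ M.mulVecLin ∘ₗ Z.subtype = ψ := by
  obtain ⟨φ, hφ⟩ := LinearMap.exists_extend ψ
  obtain ⟨g, hg⟩ := Module.projective_lifting_property Y.mkQ φ Y.mkQ_surjective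
  refine ⟨LinearMap.toMatrix' g, ?_⟩
  have : (LinearMap.toMatrix' g).mulVecLin = g := by
    rw [← Matrix.toLin'_apply', Matrix.toLin'_toMatrix']
  rw [this, ← LinearMap.comp_assoc, hg, hφ]

theorem tang_surj (hgen : DiffGen I T) (Y : Submodule ℂ (Fin h → ℂ)) :
    Function.Surjective (tang I T Y) := by
  intro ψ
  choose I' hI' using fun j => exists_mat Y _ (ψ j).1
  choose T' hT' using fun j => exists_mat Y _ (ψ j).2
  obtain ⟨δ, hδ, h1, h2⟩ := hgen I' T'
  refine ⟨(derQ δ hδ Y, fun j => derQ δ hδ (subY I T Y j)), ?_⟩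
  funext j
  rw [tang_der, h1, h2, hI', hT']

theorem finrank_tang_dom (Y : Submodule ℂ (Fin h → ℂ)) :
    Module.finrank ℂ ((Y →ₗ[ℂ] ((Fin h → ℂ) ⧸ Y)) ×
      (∀ j, subY I T Y j →ₗ[ℂ] ((Fin (d j) → ℂ) ⧸ subY I T Y j))) =
    Module.finrank ℂ Y * (h - Module.finrank ℂ Y) +
      ∑ j, Module.finrank ℂ (subY I T Y j) * (d j - Module.finrank ℂ (subY I T Y j)) := by
  rw [Module.finrank_prod, Module.finrank_pi_fintype, Module.finrank_linearMap]
  simp only [Module.finrank_linearMap, Submodule.finrank_quotient, Module.finrank_fin_fun]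

theorem finrank_tang_cod (Y : Submodule ℂ (Fin h → ℂ)) :
    Module.finrank ℂ (∀ j, (subY I T Y j →ₗ[ℂ] ((Fin h → ℂ) ⧸ Y)) ×
      (subY I T Y j →ₗ[ℂ] ((Fin h → ℂ) ⧸ Y))) =
    2 * (h - Module.finrank ℂ Y) * ∑ j, Module.finrank ℂ (subY I T Y j) := by
  have (j : J) : Module.Free ℂ ((subY I T Y j →ₗ[ℂ] ((Fin h → ℂ) ⧸ Y)) ×
      (subY I T Y j →ₗ[ℂ] ((Fin h → ℂ) ⧸ Y))) := Module.Free.of_divisionRing _ _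
  rw [Module.finrank_pi_fintype]
  simp only [Module.finrank_prod, Module.finrank_linearMap, Submodule.finrank_quotient,
    Module.finrank_fin_fun]
  rw [Finset.mul_sum]
  exact Finset.sum_congr rfl fun j _ => by ring

theorem G_ineq (hgen : DiffGen I T) (Y : Submodule ℂ (Fin h → ℂ)) :
    2 * (h - Module.finrank ℂ Y) * ∑ j, Module.finrank ℂ (subY I T Y j) ≤
    Module.finrank ℂ Y * (h - Module.finrank ℂ Y) +
      ∑ j, Module.finrank ℂ (subY I T Y j) * (d j - Module.finrank ℂ (subY I T Y j)) := by
  rw [← finrank_tang_dom, ← finrank_tang_cod]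
  exact LinearMap.finrank_le_finrank_of_surjective (tang_surj I T hgen Y)

theorem inj_of_surj_finrank {E F : Type} [AddCommGroup E] [Module ℂ E] [AddCommGroup F]
    [Module ℂ F] [FiniteDimensional ℂ E] [FiniteDimensional ℂ F] (f : E →ₗ[ℂ] F)
    (hf : Function.Surjective f) (he : Module.finrank ℂ E = Module.finrank ℂ F) :
    Function.Injective f :=
  (LinearMap.injective_iff_surjective_of_finrank_eq_finrank he).2 hf

theorem tang_inj (hgen : DiffGen I T) (Y : Submodule ℂ (Fin h → ℂ))
    (heq : 2 * (h - Module.finrank ℂ Y) * ∑ j, Module.finrank ℂ (subY I T Y j) =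
    Module.finrank ℂ Y * (h - Module.finrank ℂ Y) +
      ∑ j, Module.finrank ℂ (subY I T Y j) * (d j - Module.finrank ℂ (subY I T Y j))) :
    Function.Injective (tang I T Y) := by
  rw [← finrank_tang_dom, ← finrank_tang_cod] at heq
  exact inj_of_surj_finrank
    (E := (Y →ₗ[ℂ] ((Fin h → ℂ) ⧸ Y)) ×
      (∀ j, subY I T Y j →ₗ[ℂ] ((Fin (d j) → ℂ) ⧸ subY I T Y j)))
    (F := ∀ j, (subY I T Y j →ₗ[ℂ] ((Fin h → ℂ) ⧸ Y)) × (subY I T Y j →ₗ[ℂ] ((Fin h → ℂ) ⧸ Y)))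
    (tang I T Y) (tang_surj I T hgen Y) heq.symm

theorem joint_inj (hgen : DiffGen I T) (hd : ∀ j, d j ≤ 2 * h) (j : J) : subY I T ⊥ j = ⊥ := by
  have hG := G_ineq I T hgen ⊥
  rw [finrank_bot, Nat.sub_zero, zero_mul, zero_add, Finset.mul_sum] at hG
  have hle : ∀ i, Module.finrank ℂ (subY I T ⊥ i) ≤ d i := fun i =>
    (Submodule.finrank_le _).trans (by simp)
  by_contra hne
  have hpos : 0 < Module.finrank ℂ (subY I T ⊥ j) :=
    Nat.pos_of_ne_zero fun h0 => hne (Submodule.finrank_eq_zero.1 h0)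
  refine absurd hG (not_le.2 (Finset.sum_lt_sum (fun i _ => ?_) ⟨j, Finset.mem_univ _, ?_⟩))
  · rw [mul_comm]
    exact Nat.mul_le_mul_right _ ((Nat.sub_le _ _).trans (hd i))
  · rw [mul_comm]
    refine Nat.mul_lt_mul_of_pos_right ?_ hpos
    have := hd j; have := hle j
    omega
end Part1

section Part2

open Matrix

theorem mat_rank_add_le {m n : Type} [Finite m] [Fintype n] (A B : Matrix m n ℂ) :
    (A + B).rank ≤ A.rank + B.rank := by
  have h1 : LinearMap.range (A + B).mulVecLin ≤
      LinearMap.range A.mulVecLin ⊔ LinearMap.range B.mulVecLin := by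
    rintro _ ⟨x, rfl⟩
    rw [Matrix.mulVecLin_apply, Matrix.add_mulVec]
    exact Submodule.add_mem_sup ⟨x, rfl⟩ ⟨x, rfl⟩
  exact (Submodule.finrank_mono h1).trans (Submodule.finrank_add_le_finrank_add_finrank _ _)

theorem mat_rank_sum_le {m n J : Type} [Finite m] [Fintype n] (s : Finset J)
    (A : J → Matrix m n ℂ) : (∑ j ∈ s, A j).rank ≤ ∑ j ∈ s, (A j).rank := by
  classical
  induction s using Finset.induction_on with
  | empty => simp
  | insert a s ha ih =>
    rw [Finset.sum_insert ha, Finset.sum_insert ha]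
    exact (mat_rank_add_le _ _).trans (by omega)

theorem mat_rank_neg {m n : Type} [Finite m] [Fintype n] (A : Matrix m n ℂ) :
    (-A).rank = A.rank := by
  have : LinearMap.range (-A).mulVecLin = LinearMap.range A.mulVecLin := by
    ext y
    constructor
    · rintro ⟨x, rfl⟩; exact ⟨-x, by simp [Matrix.neg_mulVec, Matrix.mulVec_neg]⟩
    · rintro ⟨x, rfl⟩; exact ⟨-x, by simp [Matrix.neg_mulVec, Matrix.mulVec_neg]⟩
  rw [Matrix.rank, Matrix.rank, this]

theorem iso_rank_lin {E F G : Type} [AddCommGroup E] [Module ℂ E] [AddCommGroup F]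
    [Module ℂ F] [AddCommGroup G] [Module ℂ G] [FiniteDimensional ℂ E] [FiniteDimensional ℂ F]
    (p : E →ₗ[ℂ] E) (u : E →ₗ[ℂ] F) (w : G →ₗ[ℂ] E) (h0 : u ∘ₗ p ∘ₗ w = 0) :
    Module.finrank ℂ (LinearMap.range (u ∘ₗ p)) + Module.finrank ℂ (LinearMap.range (p ∘ₗ w)) ≤
      Module.finrank ℂ (LinearMap.range p) := by
  let f := u.domRestrict (LinearMap.range p)
  have h1 := LinearMap.finrank_range_add_finrank_ker f
  have h2 : LinearMap.range f = LinearMap.range (u ∘ₗ p) := by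
    ext y; constructor
    · rintro ⟨⟨_, x, rfl⟩, rfl⟩; exact ⟨x, rfl⟩
    · rintro ⟨x, rfl⟩; exact ⟨⟨p x, x, rfl⟩, rfl⟩
  have h3 : LinearMap.range (p ∘ₗ w) ≤ (LinearMap.ker f).map (LinearMap.range p).subtype := by
    rintro _ ⟨x, rfl⟩
    exact ⟨⟨p (w x), w x, rfl⟩, LinearMap.congr_fun h0 x, rfl⟩
  have h4 := Submodule.finrank_mono h3
  rw [Submodule.finrank_map_subtype_eq] at h4
  rw [h2] at h1
  omega

theorem iso_rank {m n : Type} [Fintype m] [Fintype n] (U : Matrix m n ℂ) (P : Matrix n n ℂ)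
    (hP : Pᵀ = P ∨ Pᵀ = -P) (h0 : U * P * Uᵀ = 0) : 2 * (U * P).rank ≤ P.rank := by
  have h1 := iso_rank_lin P.mulVecLin U.mulVecLin Uᵀ.mulVecLin (by
    rw [← Matrix.mulVecLin_mul, ← Matrix.mulVecLin_mul, ← Matrix.mul_assoc, h0]; simp)
  rw [← Matrix.mulVecLin_mul, ← Matrix.mulVecLin_mul] at h1
  have h2 : (P * Uᵀ).rank = (U * P).rank := by
    rw [← Matrix.rank_transpose (U * P), Matrix.transpose_mul]
    rcases hP with h | h
    · rw [h]
    · rw [h, Matrix.neg_mul, mat_rank_neg]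
  change (U * P).rank + (P * Uᵀ).rank ≤ P.rank at h1
  omega

theorem mat_mul_subone {m n p : Type} [Fintype n] [DecidableEq n] (U : Matrix m n ℂ) (f : p → n) :
    U * (1 : Matrix n n ℂ).submatrix id f = U.submatrix id f := by
  ext i j; simp [Matrix.mul_apply, Matrix.one_apply]

theorem mat_subone_mul {n p q : Type} [Fintype n] [DecidableEq n] (f : p → n) (g : q → n) :
    ((1 : Matrix n n ℂ).submatrix id f)ᵀ * (1 : Matrix n n ℂ).submatrix id g =
      (1 : Matrix n n ℂ).submatrix f g := by
  rw [mat_mul_subone]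
  ext i j; simp [Matrix.one_apply, eq_comm]

/-- The general isotropy estimate. -/
theorem iso_gen {J m : Type} [Fintype J] [Fintype m] {d : J → ℕ}
    (A B : ∀ j, Matrix m (Fin (d j)) ℂ) (C : ∀ j, Matrix (Fin (d j)) (Fin (d j)) ℂ)
    (hC : (∀ j, (C j)ᵀ = C j) ∨ (∀ j, (C j)ᵀ = - C j))
    (h0 : ∑ j, (A j * C j * (B j)ᵀ - B j * C j * (A j)ᵀ) = 0) :
    ∃ N : Matrix m (Bool × Σ j, Fin (d j)) ℂ, N.rank ≤ ∑ j, (C j).rank ∧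
      (∀ j, ∃ P : Matrix (Bool × Σ j, Fin (d j)) (Fin (d j)) ℂ, N * P = A j * C j) ∧
      (∀ j, ∃ P : Matrix (Bool × Σ j, Fin (d j)) (Fin (d j)) ℂ, N * P = B j * C j) := by
  classical
  let P : ∀ j, Matrix (Bool × Σ j, Fin (d j)) (Fin (d j)) ℂ := fun j => (1 : Matrix (Bool × Σ j, Fin (d j)) (Bool × Σ j, Fin (d j)) ℂ).submatrix id
    (fun a => (true, ⟨j, a⟩))
  let Q : ∀ j, Matrix (Bool × Σ j, Fin (d j)) (Fin (d j)) ℂ := fun j => (1 : Matrix (Bool × Σ j, Fin (d j)) (Bool × Σ j, Fin (d j)) ℂ).submatrix id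
    (fun a => (false, ⟨j, a⟩))
  let U : Matrix m (Bool × Σ j, Fin (d j)) ℂ := Matrix.of fun i k => if k.1 then A k.2.1 i k.2.2 else B k.2.1 i k.2.2
  have hUP : ∀ j, U * P j = A j := by
    intro j; rw [mat_mul_subone]; ext i a; simp [U]
  have hUQ : ∀ j, U * Q j = B j := by
    intro j; rw [mat_mul_subone]; ext i a; simp [U]
  have hPP : ∀ j, (P j)ᵀ * P j = 1 := by
    intro j; rw [mat_subone_mul]; ext a b; simp [Matrix.one_apply]
  have hQQ : ∀ j, (Q j)ᵀ * Q j = 1 := by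
    intro j; rw [mat_subone_mul]; ext a b; simp [Matrix.one_apply]
  have hPP' : ∀ i j, i ≠ j → (P i)ᵀ * P j = 0 := by
    intro i j hij; rw [mat_subone_mul]; ext a b; simp [Matrix.one_apply, hij]
  have hQQ' : ∀ i j, i ≠ j → (Q i)ᵀ * Q j = 0 := by
    intro i j hij; rw [mat_subone_mul]; ext a b; simp [Matrix.one_apply, hij]
  have hPQ : ∀ i j, (P i)ᵀ * Q j = 0 := by
    intro i j; rw [mat_subone_mul]; ext a b; simp [Matrix.one_apply]
  have hQP : ∀ i j, (Q i)ᵀ * P j = 0 := by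
    intro i j; rw [mat_subone_mul]; ext a b; simp [Matrix.one_apply]
  let M : Matrix (Bool × Σ j, Fin (d j)) (Bool × Σ j, Fin (d j)) ℂ := ∑ j, (P j * C j * (Q j)ᵀ - Q j * C j * (P j)ᵀ)
  have hM : Mᵀ = M ∨ Mᵀ = -M := by
    rcases hC with h | h
    · right
      simp only [M, Matrix.transpose_sum, ← Finset.sum_neg_distrib]
      refine Finset.sum_congr rfl fun j _ => ?_
      simp [Matrix.transpose_mul, h, Matrix.mul_assoc]
    · left
      simp only [M, Matrix.transpose_sum]
      refine Finset.sum_congr rfl fun j _ => ?_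
      simp [Matrix.transpose_mul, h, Matrix.mul_assoc]
      abel
  have hUM : U * M = ∑ j, (A j * C j * (Q j)ᵀ - B j * C j * (P j)ᵀ) := by
    simp only [M, Matrix.mul_sum, Matrix.mul_sub, ← Matrix.mul_assoc, hUP, hUQ]
  have hUMU : U * M * Uᵀ = 0 := by
    rw [hUM, ← h0]
    simp only [Matrix.sum_mul, Matrix.sub_mul, Matrix.mul_assoc, ← Matrix.transpose_mul, hUP, hUQ]
  have hr := iso_rank U M hM hUMU
  have hr2 : M.rank ≤ ∑ j, 2 * (C j).rank := by
    refine (mat_rank_sum_le _ _).trans (Finset.sum_le_sum fun j _ => ?_)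
    rw [sub_eq_add_neg]
    refine (mat_rank_add_le _ _).trans ?_
    rw [mat_rank_neg]
    have e1 : (P j * C j * (Q j)ᵀ).rank ≤ (C j).rank :=
      (Matrix.rank_mul_le_left _ _).trans (Matrix.rank_mul_le_right _ _)
    have e2 : (Q j * C j * (P j)ᵀ).rank ≤ (C j).rank :=
      (Matrix.rank_mul_le_left _ _).trans (Matrix.rank_mul_le_right _ _)
    omega
  rw [← Finset.mul_sum] at hr2
  refine ⟨U * M, by omega, fun j => ⟨Q j, ?_⟩, fun j => ⟨-P j, ?_⟩⟩
  · rw [hUM, Matrix.sum_mul, Finset.sum_eq_single j]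
    · simp [Matrix.sub_mul, Matrix.mul_assoc, hQQ, hPQ]
    · intro i _ hij
      simp [Matrix.sub_mul, Matrix.mul_assoc, hQQ' _ _ hij, hPQ]
    · simp
  · rw [hUM, Matrix.sum_mul, Finset.sum_eq_single j]
    · simp [Matrix.sub_mul, Matrix.mul_assoc, hPP, hQP]
    · intro i _ hij
      simp [Matrix.sub_mul, Matrix.mul_assoc, hPP' _ _ hij, hQP]
    · simp

variable {J : Type} [Fintype J] {h : ℕ} {d : J → ℕ}
    (I T : ∀ j, Matrix (Fin h) (Fin (d j)) ℂ)

/-- The derivative of the defining equations. -/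
theorem der_eqn {d : ℕ} (I T : Matrix (Fin h) (Fin d) ℂ) (Ω : Matrix (Fin h) (Fin h) ℂ)
    (hΩ : Iᵀ * Ω * T - Tᵀ * Ω * I = 0) (δ : ℂ →+ ℂ)
    (hδ : ∀ x y, δ (x * y) = x * δ y + δ x * y) :
    (I.map δ)ᵀ * Ω * T + Iᵀ * Ω.map δ * T + Iᵀ * Ω * T.map δ
      - (T.map δ)ᵀ * Ω * I - Tᵀ * Ω.map δ * I - Tᵀ * Ω * I.map δ = 0 := by
  have h1 : (Iᵀ * Ω * T).map δ - (Tᵀ * Ω * I).map δ = 0 := by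
    rw [sub_eq_zero.1 hΩ]; simp
  simp only [der_mul δ hδ, Matrix.transpose_map] at h1
  rw [← h1]
  simp only [Matrix.add_mul]
  abel

theorem map_der_skew {Ω : Matrix (Fin h) (Fin h) ℂ} (hsk : Ωᵀ = -Ω) (δ : ℂ →+ ℂ) :
    (Ω.map δ)ᵀ = -Ω.map δ := by
  rw [← Matrix.transpose_map, hsk]; ext i j; simp

theorem P1 (hgen : DiffGen I T) (Ω : Matrix (Fin h) (Fin h) ℂ) (hsk : Ωᵀ = -Ω)
    (hΩ : ∀ j, (I j)ᵀ * Ω * T j - (T j)ᵀ * Ω * I j = 0)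
    (C : ∀ j, Matrix (Fin (d j)) (Fin (d j)) ℂ) (hC : ∀ j, (C j)ᵀ = C j)
    (h0 : ∑ j, (T j * C j * (I j)ᵀ - I j * C j * (T j)ᵀ) = 0) :
    (∀ j, Ω * T j * C j = 0) ∧ (∀ j, Ω * I j * C j = 0) := by
  classical
  have key : ∀ I' T' : ∀ j, Matrix (Fin h) (Fin (d j)) ℂ,
      ∑ j, ((I' j)ᵀ * (Ω * T j * C j)).trace = ∑ j, ((T' j)ᵀ * (Ω * I j * C j)).trace := by
    intro I' T'
    obtain ⟨δ, hδ, h1, h2⟩ := hgen I' T'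
    have e1 : ∀ j, 2 * ((I' j)ᵀ * (Ω * T j * C j)).trace - 2 * ((T' j)ᵀ * (Ω * I j * C j)).trace
        + (Ω.map δ * (T j * C j * (I j)ᵀ - I j * C j * (T j)ᵀ)).trace = 0 := by
      intro j
      have e2 := der_eqn (I j) (T j) Ω (hΩ j) δ hδ
      rw [h1, h2] at e2
      have e3 := congrArg (fun M => (M * C j).trace) e2
      simp only [Matrix.sub_mul, Matrix.add_mul, Matrix.trace_sub, Matrix.trace_add,
        Matrix.zero_mul, Matrix.trace_zero] at e3
      have e4 : ((I j)ᵀ * Ω * T' j * C j).trace = - ((T' j)ᵀ * (Ω * I j * C j)).trace := by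
        rw [← Matrix.trace_transpose]
        simp only [Matrix.transpose_mul, Matrix.transpose_transpose, hC, hsk]
        rw [Matrix.trace_mul_comm]
        simp [Matrix.mul_assoc]
      have e5 : ((T j)ᵀ * Ω * I' j * C j).trace = - ((I' j)ᵀ * (Ω * T j * C j)).trace := by
        rw [← Matrix.trace_transpose]
        simp only [Matrix.transpose_mul, Matrix.transpose_transpose, hC, hsk]
        rw [Matrix.trace_mul_comm]
        simp [Matrix.mul_assoc]
      have e6 : ((I j)ᵀ * Ω.map δ * T j * C j).trace =
          (Ω.map δ * (T j * C j * (I j)ᵀ)).trace := by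
        rw [Matrix.mul_assoc, Matrix.mul_assoc, Matrix.trace_mul_comm]
        simp only [Matrix.mul_assoc]
      have e7 : ((T j)ᵀ * Ω.map δ * I j * C j).trace =
          (Ω.map δ * (I j * C j * (T j)ᵀ)).trace := by
        rw [Matrix.mul_assoc, Matrix.mul_assoc, Matrix.trace_mul_comm]
        simp only [Matrix.mul_assoc]
      rw [e4, e5, e6, e7] at e3
      rw [Matrix.mul_sub, Matrix.trace_sub]
      simp only [Matrix.mul_assoc] at e3 ⊢
      linear_combination e3
    have e8 := Finset.sum_eq_zero (s := Finset.univ) (fun j _ => e1 j)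
    rw [Finset.sum_add_distrib, Finset.sum_sub_distrib, ← Matrix.trace_sum, ← Matrix.mul_sum, h0,
      ← Finset.mul_sum, ← Finset.mul_sum] at e8
    simp only [Matrix.mul_zero, Matrix.trace_zero] at e8
    linear_combination e8 / 2
  constructor
  · intro j
    rw [Matrix.ext_iff_trace_mul_left]
    intro X
    have := key (Function.update 0 j Xᵀ) 0
    rw [Finset.sum_eq_single j] at this
    · simpa using this
    · intro i _ hij; simp [Function.update_of_ne hij]
    · simp
  · intro j
    rw [Matrix.ext_iff_trace_mul_left]
    intro X
    have := key 0 (Function.update 0 j Xᵀ)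
    symm at this
    rw [Finset.sum_eq_single j] at this
    · simpa using this
    · intro i _ hij; simp [Function.update_of_ne hij]
    · simp

/-- The span of the images. -/
def spanX (C : ∀ j, Matrix (Fin (d j)) (Fin (d j)) ℂ) : Submodule ℂ (Fin h → ℂ) :=
  ⨆ j, (LinearMap.range (I j * C j).mulVecLin ⊔ LinearMap.range (T j * C j).mulVecLin)

theorem range_le_of_mul {m n p : Type} [Fintype n] [Fintype p]
    {N : Matrix m n ℂ} {P : Matrix n p ℂ} {M : Matrix m p ℂ} (hh : N * P = M) :
    LinearMap.range M.mulVecLin ≤ LinearMap.range N.mulVecLin := by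
  rintro _ ⟨x, rfl⟩
  exact ⟨P *ᵥ x, by rw [← hh]; simp⟩

theorem P2 (C : ∀ j, Matrix (Fin (d j)) (Fin (d j)) ℂ) (hC : ∀ j, (C j)ᵀ = C j)
    (h0 : ∑ j, (T j * C j * (I j)ᵀ - I j * C j * (T j)ᵀ) = 0) :
    Module.finrank ℂ (spanX I T C) ≤ ∑ j, Module.finrank ℂ (subY I T (spanX I T C) j) := by
  obtain ⟨N, h1, h2, h3⟩ := iso_gen T I C (Or.inl hC) h0
  have h4 : spanX I T C ≤ LinearMap.range N.mulVecLin := by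
    refine iSup_le fun j => sup_le ?_ ?_
    · obtain ⟨P, hP⟩ := h3 j; exact range_le_of_mul hP
    · obtain ⟨P, hP⟩ := h2 j; exact range_le_of_mul hP
  refine (Submodule.finrank_mono h4).trans (h1.trans (Finset.sum_le_sum fun j _ => ?_))
  refine Submodule.finrank_mono ?_
  rintro _ ⟨x, rfl⟩
  refine (mem_subY I T _ j _).2 ⟨?_, ?_⟩
  · exact (le_sup_left.trans (le_iSup (fun j => LinearMap.range (I j * C j).mulVecLin ⊔
      LinearMap.range (T j * C j).mulVecLin) j)) ⟨x, by simp⟩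
  · exact (le_sup_right.trans (le_iSup (fun j => LinearMap.range (I j * C j).mulVecLin ⊔
      LinearMap.range (T j * C j).mulVecLin) j)) ⟨x, by simp⟩

theorem spanX_ne_bot (hinj : ∀ j, subY I T ⊥ j = ⊥) (C : ∀ j, Matrix (Fin (d j)) (Fin (d j)) ℂ)
    (hC : ∃ j, C j ≠ 0) : spanX I T C ≠ ⊥ := by
  intro hb
  obtain ⟨j, hj⟩ := hC
  apply hj
  have h1 := iSup_eq_bot.1 hb j
  rw [sup_eq_bot_iff] at h1
  refine Matrix.ext_of_mulVec_single fun i => ?_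
  rw [Matrix.zero_mulVec]
  set x : Fin (d j) → ℂ := Pi.single i 1
  have h2 : (C j) *ᵥ x ∈ subY I T ⊥ j := by
    refine (mem_subY I T _ j _).2 ⟨?_, ?_⟩
    · rw [← h1.1]; exact ⟨x, by simp⟩
    · rw [← h1.2]; exact ⟨x, by simp⟩
  rw [hinj] at h2
  exact (Submodule.mem_bot ℂ).1 h2

theorem P4 (Ω : Matrix (Fin h) (Fin h) ℂ) (hsk : Ωᵀ = -Ω) (j : J)
    (hΩ : (I j)ᵀ * Ω * T j - (T j)ᵀ * Ω * I j = 0) :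
    d j ≤ Module.finrank ℂ (subY I T (LinearMap.ker Ω.mulVecLin) j) + Ω.rank := by
  obtain ⟨N, h1, h2, h3⟩ := iso_gen (J := Unit) (d := fun _ => h) (fun _ => (I j)ᵀ)
    (fun _ => (T j)ᵀ) (fun _ => Ω) (Or.inr fun _ => hsk) (by simpa using hΩ)
  obtain ⟨P, hP⟩ := h2 ()
  obtain ⟨Q, hQ⟩ := h3 ()
  have h4 : LinearMap.ker Nᵀ.mulVecLin ≤ subY I T (LinearMap.ker Ω.mulVecLin) j := by
    intro x hx
    have hx' : Nᵀ *ᵥ x = 0 := hx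
    have e1 : (Ω * I j) *ᵥ x = 0 := by
      have : Ω * I j = -(Pᵀ * Nᵀ) := by
        rw [← Matrix.transpose_mul, hP]; simp [Matrix.transpose_mul, hsk]
      rw [this, Matrix.neg_mulVec, ← Matrix.mulVec_mulVec, hx']; simp
    have e2 : (Ω * T j) *ᵥ x = 0 := by
      have : Ω * T j = -(Qᵀ * Nᵀ) := by
        rw [← Matrix.transpose_mul, hQ]; simp [Matrix.transpose_mul, hsk]
      rw [this, Matrix.neg_mulVec, ← Matrix.mulVec_mulVec, hx']; simp
    refine (mem_subY I T _ j _).2 ⟨?_, ?_⟩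
    · simpa using e1
    · simpa using e2
  have h5 := Submodule.finrank_mono h4
  have h6 := LinearMap.finrank_range_add_finrank_ker Nᵀ.mulVecLin
  have h7 : Module.finrank ℂ (LinearMap.range Nᵀ.mulVecLin) = N.rank := Matrix.rank_transpose N
  rw [Module.finrank_fin_fun] at h6
  simp at h1
  omega

end Part2

section Part3

open Matrix

/-- Alternating (skew-symmetric) matrices. -/
def altS (n : ℕ) : Submodule ℂ (Matrix (Fin n) (Fin n) ℂ) where
  carrier := {A | Aᵀ = -A}
  add_mem' := by
    intro a b ha hb
    simp only [Set.mem_setOf_eq] at *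
    rw [Matrix.transpose_add, ha, hb]; abel
  zero_mem' := by simp
  smul_mem' := by
    intro c a ha
    simp only [Set.mem_setOf_eq] at *
    rw [Matrix.transpose_smul, ha, smul_neg]

/-- Symmetric matrices. -/
def symS (n : ℕ) : Submodule ℂ (Matrix (Fin n) (Fin n) ℂ) where
  carrier := {A | Aᵀ = A}
  add_mem' := by
    intro a b ha hb
    simp only [Set.mem_setOf_eq] at *
    rw [Matrix.transpose_add, ha, hb]
  zero_mem' := by simp
  smul_mem' := by
    intro c a ha
    simp only [Set.mem_setOf_eq] at *
    rw [Matrix.transpose_smul, ha]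

theorem mem_altS {n : ℕ} {A : Matrix (Fin n) (Fin n) ℂ} : A ∈ altS n ↔ Aᵀ = -A := Iff.rfl

theorem mem_symS {n : ℕ} {A : Matrix (Fin n) (Fin n) ℂ} : A ∈ symS n ↔ Aᵀ = A := Iff.rfl

/-- Symmetric matrices as functions on unordered pairs. -/
def symSEquiv (n : ℕ) : symS n ≃ₗ[ℂ] (Sym2 (Fin n) → ℂ) where
  toFun A := fun p => Sym2.lift ⟨fun i j => A.1 i j, fun i j => by
    conv_lhs => rw [← mem_symS.1 A.2]
    rfl⟩ p
  map_add' A B := by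
    funext p
    induction p using Sym2.ind with
    | _ i j => simp
  map_smul' c A := by
    funext p
    induction p using Sym2.ind with
    | _ i j => simp
  invFun f := ⟨Matrix.of fun i j => f s(i, j), by
    rw [mem_symS]; ext i j; simp [Sym2.eq_swap]⟩
  left_inv A := by ext i j; simp
  right_inv f := by
    funext p
    induction p using Sym2.ind with
    | _ i j => simp

theorem finrank_symS (n : ℕ) : Module.finrank ℂ (symS n) = (n + 1).choose 2 := by
  rw [(symSEquiv n).finrank_eq, Module.finrank_fintype_fun_eq_card, Sym2.card, Fintype.card_fin]

theorem finrank_altS (n : ℕ) : Module.finrank ℂ (altS n) = n.choose 2 := by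
  let f : Matrix (Fin n) (Fin n) ℂ →ₗ[ℂ] Matrix (Fin n) (Fin n) ℂ :=
    LinearMap.id - (Matrix.transposeLinearEquiv (Fin n) (Fin n) ℂ ℂ).toLinearMap
  have hf : ∀ A, f A = A - Aᵀ := fun A => rfl
  have h1 := LinearMap.finrank_range_add_finrank_ker f
  have h2 : LinearMap.ker f = symS n := by
    ext A
    rw [LinearMap.mem_ker, hf, mem_symS, sub_eq_zero, eq_comm]
  have h3 : LinearMap.range f = altS n := by
    ext A
    rw [mem_altS]
    constructor
    · rintro ⟨B, rfl⟩
      rw [hf]; simp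
    · intro hA
      refine ⟨(1 / 2 : ℂ) • A, ?_⟩
      rw [hf, Matrix.transpose_smul, hA, smul_neg, sub_neg_eq_add, ← add_smul]
      norm_num
  rw [h2, h3, finrank_symS, Module.finrank_matrix] at h1
  simp only [Fintype.card_fin, Module.finrank_self, mul_one] at h1
  have h4 : n.choose 2 + (n + 1).choose 2 = n * n := by
    have := Nat.triangle_succ n
    rw [Nat.choose_succ_succ' n 1, Nat.choose_one_right, Nat.choose_two_right]
    have h5 : n * (n - 1) / 2 * 2 = n * (n - 1) :=
      Nat.div_mul_cancel (Nat.even_mul_pred_self n).two_dvd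
    cases n with
    | zero => rfl
    | succ k => simp at *; nlinarith
  omega

theorem exists_coord {n z : ℕ} (R : Submodule ℂ (Fin n → ℂ)) (hz : n = Module.finrank ℂ R + z) :
    ∃ (B : Matrix (Fin z) (Fin n) ℂ) (B' : Matrix (Fin n) (Fin z) ℂ), B * B' = 1 ∧
      ∀ x, B *ᵥ x = 0 ↔ x ∈ R := by
  have h1 : Module.finrank ℂ ((Fin n → ℂ) ⧸ R) = Module.finrank ℂ (Fin z → ℂ) := by
    rw [Submodule.finrank_quotient, Module.finrank_fin_fun, Module.finrank_fin_fun]; omega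
  let e := LinearEquiv.ofFinrankEq _ _ h1
  let f := e.toLinearMap ∘ₗ R.mkQ
  have hf : Function.Surjective f := e.surjective.comp R.mkQ_surjective
  obtain ⟨g, hg⟩ := f.exists_rightInverse_of_surjective (LinearMap.range_eq_top.2 hf)
  refine ⟨LinearMap.toMatrix' f, LinearMap.toMatrix' g, ?_, ?_⟩
  · rw [← LinearMap.toMatrix'_comp, hg, LinearMap.toMatrix'_id]
  · intro x
    rw [← Matrix.toLin'_apply, Matrix.toLin'_toMatrix']
    simp [f]

theorem exists_factor {n p q r : ℕ} (A : Matrix (Fin p) (Fin n) ℂ) (B : Matrix (Fin q) (Fin n) ℂ)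
    (E : Matrix (Fin r) (Fin n) ℂ) (hk : ∀ x, A *ᵥ x = 0 → B *ᵥ x = 0 → E *ᵥ x = 0) :
    ∃ (G : Matrix (Fin r) (Fin p) ℂ) (H : Matrix (Fin r) (Fin q) ℂ), E = G * A + H * B := by
  let f := A.mulVecLin.prod B.mulVecLin
  have hker : LinearMap.ker f ≤ LinearMap.ker E.mulVecLin := by
    intro x hx
    have : (A *ᵥ x, B *ᵥ x) = 0 := hx
    rw [Prod.mk_eq_zero] at this
    exact hk x this.1 this.2
  let g0 := (LinearMap.ker f).liftQ E.mulVecLin hker ∘ₗ f.quotKerEquivRange.symm.toLinearMap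
  obtain ⟨g, hg⟩ := LinearMap.exists_extend g0
  have hg1 : ∀ x, g (f x) = E *ᵥ x := by
    intro x
    have h1 := LinearMap.congr_fun hg ⟨f x, x, rfl⟩
    have h2 : f.quotKerEquivRange.symm ⟨f x, x, rfl⟩ = Submodule.Quotient.mk x := by
      rw [LinearEquiv.symm_apply_eq]; rfl
    simp only [LinearMap.comp_apply, Submodule.subtype_apply, g0, LinearEquiv.coe_coe, h2] at h1
    exact h1
  refine ⟨LinearMap.toMatrix' (g ∘ₗ LinearMap.inl ℂ _ _),
    LinearMap.toMatrix' (g ∘ₗ LinearMap.inr ℂ _ _), ?_⟩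
  refine Matrix.ext_of_mulVec_single fun i => ?_
  set x : Fin n → ℂ := Pi.single i 1
  have ht : ∀ (a : ℕ) (g : (Fin a → ℂ) →ₗ[ℂ] (Fin r → ℂ)) (y : Fin a → ℂ),
      LinearMap.toMatrix' g *ᵥ y = g y := fun a g y => by
    rw [← Matrix.toLin'_apply, Matrix.toLin'_toMatrix']
  rw [Matrix.add_mulVec, ← Matrix.mulVec_mulVec, ← Matrix.mulVec_mulVec, ht, ht, ← hg1]
  simp only [LinearMap.comp_apply]
  rw [← map_add]
  congr 1
  simp [f]

variable {J : Type} [Fintype J] {h : ℕ} {d : J → ℕ}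
    (I T : ∀ j, Matrix (Fin h) (Fin (d j)) ℂ)

/-- The tie case is impossible. -/
theorem P6 (hgen : DiffGen I T) (Ω : Matrix (Fin h) (Fin h) ℂ) (hsk : Ωᵀ = -Ω)
    (hΩ : ∀ j, (I j)ᵀ * Ω * T j - (T j)ᵀ * Ω * I j = 0)
    (hinj : Function.Injective (tang I T (LinearMap.ker Ω.mulVecLin)))
    (i : J) (z : ℕ) (hz : 1 ≤ z)
    (hz1 : h = Module.finrank ℂ (LinearMap.ker Ω.mulVecLin) + z)
    (hz2 : d i = Module.finrank ℂ (subY I T (LinearMap.ker Ω.mulVecLin) i) + z) : False := by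
  classical
  obtain ⟨B, B', hB, hBR⟩ := exists_coord _ hz1
  obtain ⟨E, E', hE, hER⟩ := exists_coord _ hz2
  obtain ⟨G, H, hGH⟩ := exists_factor (Ω * T i) (Ω * I i) E (by
    intro x hx1 hx2
    rw [hER, mem_subY]
    exact ⟨by simpa using hx2, by simpa using hx1⟩)
  let f : Matrix (Fin z) (Fin z) ℂ →ₗ[ℂ] Matrix (Fin z) (Fin z) ℂ :=
    { toFun := fun Θ => E'ᵀ * ((T i)ᵀ * (Bᵀ * Θ * B) * I i - (I i)ᵀ * (Bᵀ * Θ * B) * T i) * E'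
      map_add' := by
        intro x y
        simp only [Matrix.mul_add, Matrix.add_mul, Matrix.mul_sub, Matrix.sub_mul]; abel
      map_smul' := by
        intro c x
        simp only [Matrix.mul_smul, Matrix.smul_mul, Matrix.mul_sub, Matrix.sub_mul, smul_sub,
          RingHom.id_apply] }
  have key : symS z ≤ (altS z).map f := by
    intro Ψ hΨ
    rw [mem_symS] at hΨ
    let I' : Matrix (Fin h) (Fin (d i)) ℂ := (1 / 2 : ℂ) • (Gᵀ * Ψ * E)
    let T' : Matrix (Fin h) (Fin (d i)) ℂ := -((1 / 2 : ℂ) • (Hᵀ * Ψ * E))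
    obtain ⟨δ, hδ, h1, h2⟩ := hgen (Function.update 0 i I') (Function.update 0 i T')
    have hkill : ∀ x ∈ subY I T (LinearMap.ker Ω.mulVecLin) i, I' *ᵥ x = 0 ∧ T' *ᵥ x = 0 := by
      intro x hx
      have := (hER x).2 hx
      simp [I', T', Matrix.smul_mulVec, Matrix.neg_mulVec, ← Matrix.mulVec_mulVec, this]
    have ht : tang I T (LinearMap.ker Ω.mulVecLin) (derQ δ hδ _, fun j => derQ δ hδ _) = 0 := by
      funext j
      rw [tang_der, h1, h2]
      by_cases hj : j = i
      · subst hj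
        simp only [Function.update_self]
        refine Prod.ext ?_ ?_
        · refine LinearMap.ext fun x => ?_
          simp [(hkill x.1 x.2).1]
        · refine LinearMap.ext fun x => ?_
          simp [(hkill x.1 x.2).2]
      · rw [Function.update_of_ne hj, Function.update_of_ne hj]
        refine Prod.ext ?_ ?_
        · refine LinearMap.ext fun x => ?_
          simp
        · refine LinearMap.ext fun x => ?_
          simp
    have hρ := hinj (ht.trans (map_zero _).symm)
    have hρ1 : derQ δ hδ (LinearMap.ker Ω.mulVecLin) = 0 := congrArg Prod.fst hρ
    have hkillΩ : ∀ x, Ω *ᵥ x = 0 → (Ω.map δ) *ᵥ x = 0 := by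
      intro x hx
      have e1 := LinearMap.congr_fun hρ1 ⟨x, hx⟩
      have e2 : Ω *ᵥ (fun i => δ (x i)) = 0 := by
        have : (fun i => δ (x i)) ∈ LinearMap.ker Ω.mulVecLin :=
          (Submodule.Quotient.mk_eq_zero _).1 e1
        exact this
      have e3 := der_mulVec δ hδ Ω x
      rw [hx, e2, zero_add] at e3
      rw [← e3]; ext i; simp
    have hsk' := map_der_skew hsk δ
    have hd1 := der_eqn (I i) (T i) Ω (hΩ i) δ hδ
    rw [h1, h2] at hd1
    simp only [Function.update_self] at hd1
    set Ω' := Ω.map δ with hΩ'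
    have hΘ1 : Ω' = Ω' * B' * B := by
      refine Matrix.ext_of_mulVec_single fun k => ?_
      set x : Fin h → ℂ := Pi.single k 1
      have e1 : Ω *ᵥ (x - B' *ᵥ (B *ᵥ x)) = 0 := by
        have : x - B' *ᵥ (B *ᵥ x) ∈ LinearMap.ker Ω.mulVecLin := by
          rw [← hBR, Matrix.mulVec_sub, Matrix.mulVec_mulVec, hB, Matrix.one_mulVec, sub_self]
        exact this
      have e2 := hkillΩ _ e1
      rw [Matrix.mulVec_sub, sub_eq_zero] at e2
      exact e2.trans (by rw [Matrix.mulVec_mulVec, Matrix.mulVec_mulVec, Matrix.mul_assoc])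
    have hΘ2 : Ω' = Bᵀ * (B'ᵀ * Ω' * B') * B := by
      have e1 := congrArg Matrix.transpose hΘ1
      simp only [Matrix.transpose_mul, hsk', Matrix.mul_neg, neg_inj] at e1
      calc Ω' = Ω' * B' * B := hΘ1
        _ = (Bᵀ * (B'ᵀ * Ω')) * B' * B := by rw [← e1]
        _ = _ := by simp only [Matrix.mul_assoc]
    refine ⟨B'ᵀ * Ω' * B', ?_, ?_⟩
    · change _ = _
      simp [Matrix.transpose_mul, hsk', Matrix.mul_assoc]
    · change E'ᵀ * ((T i)ᵀ * (Bᵀ * (B'ᵀ * Ω' * B') * B) * I i -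
        (I i)ᵀ * (Bᵀ * (B'ᵀ * Ω' * B') * B) * T i) * E' = Ψ
      rw [← hΘ2]
      have e0 : E'ᵀ * Eᵀ = 1 := by rw [← Matrix.transpose_mul, hE]; simp
      have e2 : I'ᵀ * Ω * T i - T'ᵀ * Ω * I i = (1 / 2 : ℂ) • (Eᵀ * Ψ * E) := by
        conv_rhs => rw [hGH]
        simp only [I', T', Matrix.transpose_smul, Matrix.transpose_neg, Matrix.transpose_mul,
          Matrix.transpose_transpose, hΨ, Matrix.neg_mul, sub_neg_eq_add, Matrix.smul_mul,
          ← smul_add, Matrix.mul_add, Matrix.mul_assoc]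
        rw [hGH]
      have e3 : (I i)ᵀ * Ω * T' - (T i)ᵀ * Ω * I' = (1 / 2 : ℂ) • (Eᵀ * Ψ * E) := by
        have := congrArg Matrix.transpose e2
        simp only [Matrix.transpose_sub, Matrix.transpose_smul, Matrix.transpose_mul,
          Matrix.transpose_transpose, hΨ, hsk, Matrix.mul_neg, Matrix.neg_mul,
          Matrix.mul_assoc] at this
        simp only [Matrix.mul_assoc]
        rw [← this]; abel
      have e4 : (T i)ᵀ * Ω' * I i - (I i)ᵀ * Ω' * T i = Eᵀ * Ψ * E := by
        have e5 : Eᵀ * Ψ * E = (1 / 2 : ℂ) • (Eᵀ * Ψ * E) + (1 / 2 : ℂ) • (Eᵀ * Ψ * E) := by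
          rw [← add_smul]; norm_num
        rw [e5]
        nth_rewrite 1 [← e2]
        rw [← e3, ← sub_eq_zero, ← neg_eq_zero, ← hd1]
        abel
      rw [e4]
      calc E'ᵀ * (Eᵀ * Ψ * E) * E' = (E'ᵀ * Eᵀ) * Ψ * (E * E') := by simp only [Matrix.mul_assoc]
        _ = Ψ := by rw [e0, hE]; simp
  have h1 := Submodule.finrank_mono key
  have h2 := Submodule.finrank_map_le f (altS z)
  rw [finrank_symS] at h1
  rw [finrank_altS] at h2
  rw [Nat.choose_succ_succ' z 1, Nat.choose_one_right] at h1
  norm_num at h1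
  omega

end Part3

section Part4

open Matrix

theorem tie_arith {J : Type} [Fintype J] (d xs rs : J → ℕ) (h x r z : ℕ)
    (hG1 : 2 * (h - x) * ∑ j, xs j ≤ x * (h - x) + ∑ j, xs j * (d j - xs j))
    (hx : x ≤ ∑ j, xs j) (hx1 : 1 ≤ x) (hxr : x ≤ r) (hz : h = r + z) (hz1 : 1 ≤ z)
    (hd : ∀ j, d j ≤ rs j + z) (hxs : ∀ j, xs j ≤ rs j)
    (hG2 : 2 * (h - r) * ∑ j, rs j ≤ r * (h - r) + ∑ j, rs j * (d j - rs j)) :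
    (2 * (h - r) * ∑ j, rs j = r * (h - r) + ∑ j, rs j * (d j - rs j)) ∧
      ∃ i, d i = rs i + z := by
  classical
  have hhr : h - r = z := by omega
  rw [hhr] at hG2 ⊢
  have a1 : (h - x) * ∑ j, xs j ≤ ∑ j, xs j * (d j - xs j) := by
    have : x * (h - x) ≤ (h - x) * ∑ j, xs j := by
      rw [mul_comm]; exact Nat.mul_le_mul_left _ hx
    nlinarith
  have a2 : ∃ j, 0 < xs j ∧ h - x ≤ d j - xs j := by
    by_contra hcon
    push Not at hcon
    have hpos : ∃ j ∈ Finset.univ, 0 < xs j := by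
      by_contra hc
      push Not at hc
      have : ∑ j, xs j = 0 := Finset.sum_eq_zero fun j hj => by have := hc j hj; omega
      omega
    obtain ⟨j, -, hj⟩ := hpos
    rw [Finset.mul_sum] at a1
    refine absurd a1 (not_le.2 (Finset.sum_lt_sum (fun i _ => ?_) ⟨j, Finset.mem_univ _, ?_⟩))
    · rcases Nat.eq_zero_or_pos (xs i) with h0 | h0
      · simp [h0]
      · rw [mul_comm (h - x)]; exact Nat.mul_le_mul_left _ (hcon i h0).le
    · rw [mul_comm (h - x)]; exact Nat.mul_lt_mul_of_pos_left (hcon j hj) hj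
  obtain ⟨j, hj, hj2⟩ := a2
  have a3 : r ≤ ∑ i, rs i := by
    have e1 := Finset.add_sum_erase Finset.univ rs (Finset.mem_univ j)
    have e2 := Finset.add_sum_erase Finset.univ xs (Finset.mem_univ j)
    have e3 : ∑ i ∈ Finset.univ.erase j, xs i ≤ ∑ i ∈ Finset.univ.erase j, rs i :=
      Finset.sum_le_sum fun i _ => hxs i
    have := hd j
    omega
  have a4 : ∑ i, rs i * (d i - rs i) ≤ z * ∑ i, rs i := by
    rw [Finset.mul_sum]
    refine Finset.sum_le_sum fun i _ => ?_
    rw [mul_comm]; exact Nat.mul_le_mul_right _ (by have := hd i; omega)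
  have a5 : ∑ i, rs i = r := by
    refine le_antisymm ?_ a3
    have : z * ∑ i, rs i ≤ z * r := by nlinarith
    exact Nat.le_of_mul_le_mul_left this hz1
  rw [a5] at a4 hG2 ⊢
  have a6 : 2 * z * r = r * z + ∑ i, rs i * (d i - rs i) := by nlinarith
  refine ⟨a6, ?_⟩
  by_contra hcon
  push Not at hcon
  have hpos : ∃ j ∈ Finset.univ, 0 < rs j := by
    by_contra hc
    push Not at hc
    have : ∑ j, rs j = 0 := Finset.sum_eq_zero fun j hj => by have := hc j hj; omega
    omega
  obtain ⟨k, -, hk⟩ := hpos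
  have : ∑ i, rs i * (d i - rs i) < ∑ i, rs i * z := by
    refine Finset.sum_lt_sum (fun i _ => ?_) ⟨k, Finset.mem_univ _, ?_⟩
    · exact Nat.mul_le_mul_left _ (by have := hd i; omega)
    · refine Nat.mul_lt_mul_of_pos_left ?_ hk
      have := hd k
      have := hcon k
      omega
  rw [← Finset.sum_mul, a5] at this
  nlinarith

variable {J : Type} [Fintype J] {h : ℕ} {d : J → ℕ}
    (I T : ∀ j, Matrix (Fin h) (Fin (d j)) ℂ)

theorem subY_mono {X Y : Submodule ℂ (Fin h → ℂ)} (hXY : X ≤ Y) (j : J) :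
    subY I T X j ≤ subY I T Y j := fun _ hx => ⟨hXY hx.1, hXY hx.2⟩

/-- No simultaneous kernel and cokernel. -/
theorem main_excl (hgen : DiffGen I T) (hd : ∀ j, d j ≤ 2 * h)
    (Ω : Matrix (Fin h) (Fin h) ℂ) (hsk : Ωᵀ = -Ω) (hΩ0 : Ω ≠ 0)
    (hΩ : ∀ j, (I j)ᵀ * Ω * T j - (T j)ᵀ * Ω * I j = 0)
    (C : ∀ j, Matrix (Fin (d j)) (Fin (d j)) ℂ) (hC : ∀ j, (C j)ᵀ = C j)
    (hC0 : ∃ j, C j ≠ 0)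
    (h0 : ∑ j, (T j * C j * (I j)ᵀ - I j * C j * (T j)ᵀ) = 0) : False := by
  obtain ⟨p1, p2⟩ := P1 I T hgen Ω hsk hΩ C hC h0
  have hXR : spanX I T C ≤ LinearMap.ker Ω.mulVecLin := by
    refine iSup_le fun j => sup_le ?_ ?_
    · rintro _ ⟨x, rfl⟩
      rw [LinearMap.mem_ker, Matrix.mulVecLin_apply, Matrix.mulVecLin_apply, Matrix.mulVec_mulVec,
        ← Matrix.mul_assoc, p2, Matrix.zero_mulVec]
    · rintro _ ⟨x, rfl⟩
      rw [LinearMap.mem_ker, Matrix.mulVecLin_apply, Matrix.mulVecLin_apply, Matrix.mulVec_mulVec,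
        ← Matrix.mul_assoc, p1, Matrix.zero_mulVec]
  have hrk : h = Module.finrank ℂ (LinearMap.ker Ω.mulVecLin) + Ω.rank := by
    have := LinearMap.finrank_range_add_finrank_ker Ω.mulVecLin
    rw [Module.finrank_fin_fun] at this
    unfold Matrix.rank
    omega
  have hz1 : 1 ≤ Ω.rank := by
    by_contra hc
    apply hΩ0
    have : Ω.rank = 0 := by omega
    have h2 := Submodule.finrank_eq_zero.1 this
    rw [LinearMap.range_eq_bot] at h2
    refine Matrix.ext_of_mulVec_single fun k => ?_
    rw [Matrix.zero_mulVec]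
    exact LinearMap.congr_fun h2 _
  have hx1 : 1 ≤ Module.finrank ℂ (spanX I T C) := by
    rw [Nat.one_le_iff_ne_zero, Ne, Submodule.finrank_eq_zero]
    exact spanX_ne_bot I T (joint_inj I T hgen hd) C hC0
  obtain ⟨heq, i, hi⟩ := tie_arith d _ _ h _ _ Ω.rank (G_ineq I T hgen (spanX I T C))
    (P2 I T C hC h0) hx1 (Submodule.finrank_mono hXR) hrk hz1
    (fun j => P4 I T Ω hsk j (hΩ j)) (fun j => Submodule.finrank_mono (subY_mono I T hXR j))
    (G_ineq I T hgen (LinearMap.ker Ω.mulVecLin))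
  exact P6 I T hgen Ω hsk hΩ (tang_inj I T hgen _ heq) i Ω.rank hz1 hrk hi

/-- The linear map `Ω ↦ (Iᵀ Ω T - Tᵀ Ω I)_j`. -/
def Astar : altS h →ₗ[ℂ] (∀ j, symS (d j)) where
  toFun Ω := fun j => ⟨(I j)ᵀ * Ω.1 * T j - (T j)ᵀ * Ω.1 * I j, by
    have := mem_altS.1 Ω.2
    rw [mem_symS]
    simp only [Matrix.transpose_sub, Matrix.transpose_mul, Matrix.transpose_transpose, this,
      Matrix.mul_neg, Matrix.neg_mul, Matrix.mul_assoc]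
    abel⟩
  map_add' x y := by
    funext j
    apply Subtype.ext
    simp only [Submodule.coe_add, Pi.add_apply, Matrix.mul_add, Matrix.add_mul]
    abel
  map_smul' c x := by
    funext j
    apply Subtype.ext
    simp only [Submodule.coe_smul, Pi.smul_apply, Matrix.mul_smul, Matrix.smul_mul,
      RingHom.id_apply, smul_sub]

/-- The trace pairing. -/
def trPair (d : J → ℕ) : (∀ j, symS (d j)) →ₗ[ℂ] Module.Dual ℂ (∀ j, symS (d j)) :=
  LinearMap.mk₂ ℂ (fun C Y => ∑ j, ((C j).1 * (Y j).1).trace)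
    (by intros; simp [Matrix.add_mul, Finset.sum_add_distrib])
    (by intros; simp [Finset.mul_sum])
    (by intros; simp [Matrix.mul_add, Finset.sum_add_distrib])
    (by intros; simp [Finset.mul_sum])

theorem trPair_apply (C Y : ∀ j, symS (d j)) :
    trPair d C Y = ∑ j, ((C j).1 * (Y j).1).trace := rfl

theorem trPair_inj : Function.Injective (trPair d) := by
  classical
  rw [← LinearMap.ker_eq_bot, LinearMap.ker_eq_bot']
  intro C hC
  funext j
  apply Subtype.ext
  change (C j).1 = 0
  rw [Matrix.ext_iff_trace_mul_right]
  intro X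
  have hs : X + Xᵀ ∈ symS (d j) := by rw [mem_symS]; simp [add_comm]
  have h1 := LinearMap.congr_fun hC (Pi.single j ⟨X + Xᵀ, hs⟩)
  rw [trPair_apply, Finset.sum_eq_single j] at h1
  · rw [Pi.single_eq_same] at h1
    simp only [Matrix.mul_add, Matrix.trace_add, LinearMap.zero_apply] at h1
    have h2 : ((C j).1 * Xᵀ).trace = ((C j).1 * X).trace := by
      rw [← Matrix.trace_transpose, Matrix.transpose_mul, Matrix.transpose_transpose,
        mem_symS.1 (C j).2, Matrix.trace_mul_comm]
    rw [h2] at h1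
    rw [Matrix.zero_mul, Matrix.trace_zero]
    linear_combination h1 / 2
  · intro i _ hi
    rw [Pi.single_eq_of_ne hi]; simp
  · simp

theorem Astar_alt (hgen : DiffGen I T) (hd : ∀ j, d j ≤ 2 * h) :
    Function.Injective (Astar I T) ∨ Function.Surjective (Astar I T) := by
  by_contra hcon
  push Not at hcon
  obtain ⟨hi, hs⟩ := hcon
  rw [← LinearMap.ker_eq_bot, Submodule.eq_bot_iff] at hi
  push Not at hi
  obtain ⟨Ω, hΩ, hΩ0⟩ := hi
  rw [← LinearMap.range_eq_top] at hs
  replace hs := lt_top_iff_ne_top.2 hs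
  obtain ⟨f, hf0, hf⟩ := Submodule.exists_le_ker_of_lt_top _ hs
  obtain ⟨C, rfl⟩ := (LinearMap.injective_iff_surjective_of_finrank_eq_finrank
    (Subspace.dual_finrank_eq (K := ℂ) (V := ∀ j, symS (d j))).symm).1 trPair_inj f
  refine main_excl I T hgen hd Ω.1 (mem_altS.1 Ω.2) (fun hc => hΩ0 (Subtype.ext hc))
    (fun j => congrArg Subtype.val (congrFun hΩ j)) (fun j => (C j).1)
    (fun j => mem_symS.1 (C j).2) ?_ ?_
  · by_contra hc
    push Not at hc
    apply hf0
    have : C = 0 := funext fun j => Subtype.ext (hc j)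
    rw [this, map_zero]
  · set M := ∑ j, (T j * (C j).1 * (I j)ᵀ - I j * (C j).1 * (T j)ᵀ) with hM
    have hMt : Mᵀ = -M := by
      rw [hM, Matrix.transpose_sum, ← Finset.sum_neg_distrib]
      refine Finset.sum_congr rfl fun j _ => ?_
      simp only [Matrix.transpose_sub, Matrix.transpose_mul, Matrix.transpose_transpose,
        mem_symS.1 (C j).2, Matrix.mul_assoc]
      abel
    rw [Matrix.ext_iff_trace_mul_right]
    intro X
    have hX : X - Xᵀ ∈ altS h := by rw [mem_altS]; simp
    have h1 : trPair d C (Astar I T ⟨X - Xᵀ, hX⟩) = 0 := hf ⟨_, rfl⟩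
    have h2 : trPair d C (Astar I T ⟨X - Xᵀ, hX⟩) = (M * (X - Xᵀ)).trace := by
      rw [trPair_apply, hM, Finset.sum_mul, Matrix.trace_sum]
      refine Finset.sum_congr rfl fun j _ => ?_
      change ((C j).1 * ((I j)ᵀ * (X - Xᵀ) * T j - (T j)ᵀ * (X - Xᵀ) * I j)).trace = _
      rw [Matrix.mul_sub, Matrix.sub_mul, Matrix.trace_sub, Matrix.trace_sub]
      congr 1
      · rw [← Matrix.mul_assoc, Matrix.trace_mul_comm]
        simp only [Matrix.mul_assoc]
      · rw [← Matrix.mul_assoc, Matrix.trace_mul_comm]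
        simp only [Matrix.mul_assoc]
    have h3 : (M * Xᵀ).trace = - (M * X).trace := by
      rw [← Matrix.trace_transpose, Matrix.transpose_mul, Matrix.transpose_transpose,
        hMt, Matrix.mul_neg, Matrix.trace_neg, Matrix.trace_mul_comm]
    rw [h1, Matrix.mul_sub, Matrix.trace_sub, h3] at h2
    rw [Matrix.zero_mul, Matrix.trace_zero]
    linear_combination -h2 / 2

theorem Astar_ker (hgen : DiffGen I T) (hd : ∀ j, d j ≤ 2 * h) :
    (Module.finrank ℂ (LinearMap.ker (Astar I T)) : ℤ) =
      max ((h.choose 2 : ℤ) - ∑ j, ((d j + 1).choose 2 : ℤ)) 0 := by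
  have h1 := LinearMap.finrank_range_add_finrank_ker (Astar I T)
  have h2 : Module.finrank ℂ (∀ j, symS (d j)) = ∑ j, (d j + 1).choose 2 := by
    rw [Module.finrank_pi_fintype]
    exact Finset.sum_congr rfl fun j _ => finrank_symS _
  have h3 := Submodule.finrank_le (LinearMap.range (Astar I T))
  rw [h2] at h3
  rw [finrank_altS] at h1
  have h5 : (∑ j, ((d j + 1).choose 2 : ℤ)) = ((∑ j, (d j + 1).choose 2 : ℕ) : ℤ) := by push_cast; rfl
  rw [h5]
  rcases Astar_alt I T hgen hd with h4 | h4
  · rw [← LinearMap.ker_eq_bot] at h4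
    rw [h4, finrank_bot] at h1 ⊢
    rw [max_eq_right] <;> omega
  · rw [← LinearMap.range_eq_top] at h4
    rw [h4, finrank_top, h2] at h1
    rw [max_eq_left] <;> omega

end Part4

section Part5

open Matrix

theorem quad_zero_of_skew {n : ℕ} (S : Matrix (Fin n) (Fin n) ℂ) (hS : Sᵀ = -S) (x : Fin n → ℂ) :
    x ⬝ᵥ S *ᵥ x = 0 := by
  have h1 : x ⬝ᵥ S *ᵥ x = x ⬝ᵥ Sᵀ *ᵥ x := by
    rw [Matrix.mulVec_transpose, Matrix.dotProduct_mulVec, dotProduct_comm]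
  rw [hS, Matrix.neg_mulVec, dotProduct_neg] at h1
  linear_combination h1 / 2

theorem skew_of_quad_zero {n : ℕ} (S : Matrix (Fin n) (Fin n) ℂ)
    (hS : ∀ x : Fin n → ℂ, x ⬝ᵥ S *ᵥ x = 0) : Sᵀ = -S := by
  ext i j
  have h1 := hS (Pi.single i 1 + Pi.single j 1)
  have h2 := hS (Pi.single i 1)
  have h3 := hS (Pi.single j 1)
  simp only [Matrix.mulVec_add, add_dotProduct, dotProduct_add, single_dotProduct,
    Matrix.mulVec_single, MulOpposite.op_one, one_smul, one_mul, Matrix.col_apply] at h1 h2 h3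
  rw [Matrix.transpose_apply, Matrix.neg_apply]
  linear_combination h1 - h2 - h3

variable {E : Type} [AddCommGroup E] [Module ℂ E] {h : ℕ} {P Q R : Type}
  [AddCommGroup P] [Module ℂ P] [AddCommGroup Q] [Module ℂ Q] [AddCommGroup R] [Module ℂ R]
  (e : ((Fin h → ℂ) × (Fin h → ℂ) × P × Q × R) ≃ₗ[ℂ] E)

/-- The quadratic form `x ⬝ Ω y` on the model space. -/
def qOf (Ω : Matrix (Fin h) (Fin h) ℂ) : QuadraticForm ℂ E :=
  LinearMap.BilinMap.toQuadraticMap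
    ((Matrix.toLinearMap₂' ℂ Ω).compl₁₂ (LinearMap.fst ℂ _ _ ∘ₗ e.symm.toLinearMap)
      (LinearMap.fst ℂ _ _ ∘ₗ LinearMap.snd ℂ _ _ ∘ₗ e.symm.toLinearMap))

theorem qOf_apply (Ω : Matrix (Fin h) (Fin h) ℂ) (p : (Fin h → ℂ) × (Fin h → ℂ) × P × Q × R) :
    qOf e Ω (e p) = p.1 ⬝ᵥ Ω *ᵥ p.2.1 := by
  simp [qOf, Matrix.toLinearMap₂'_apply']

variable {J : Type} [Fintype J] {d : J → ℕ} (I T : ∀ j, Matrix (Fin h) (Fin (d j)) ℂ)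

/-- `qOf` as a linear map. -/
def qLin : LinearMap.ker (Astar I T) →ₗ[ℂ] QuadraticForm ℂ E where
  toFun Ω := qOf e Ω.1.1
  map_add' Ω Ω' := by
    ext v
    obtain ⟨p, rfl⟩ := e.surjective v
    simp [qOf_apply, Matrix.add_mulVec]
  map_smul' c Ω := by
    ext v
    obtain ⟨p, rfl⟩ := e.surjective v
    simp [qOf_apply, Matrix.smul_mulVec]

theorem qLin_inj : Function.Injective (qLin e I T) := by
  intro Ω Ω' hh
  apply Subtype.ext
  apply Subtype.ext
  ext i j
  have h1 := congrArg (fun q : QuadraticForm ℂ E => q (e (Pi.single i 1, Pi.single j 1, 0, 0, 0))) hh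
  change qOf e _ _ = qOf e _ _ at h1
  rw [qOf_apply, qOf_apply] at h1
  simpa using h1

theorem polar_zero (q : QuadraticForm ℂ E) {u w : E} (h1 : q u = 0) (h2 : q w = 0)
    (h3 : q (u + w) = 0) : QuadraticMap.polar q u w = 0 := by
  simp [QuadraticMap.polar, h1, h2, h3]

theorem core (S : Submodule ℂ (QuadraticForm ℂ E))
    (hS : ∀ q, q ∈ S ↔ (∀ x b c, q (e (x, 0, 0, b, c)) = 0) ∧ (∀ y a c, q (e (0, y, a, 0, c)) = 0) ∧
      (∀ x a b, q (e (x, x, a, b, 0)) = 0) ∧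
      ∀ j x, q (e (I j *ᵥ x, T j *ᵥ x, 0, 0, 0)) = 0) :
    Module.finrank ℂ S = Module.finrank ℂ (LinearMap.ker (Astar I T)) := by
  have hr : LinearMap.range (qLin e I T) = S := by
    ext q
    rw [hS]
    constructor
    · rintro ⟨Ω, rfl⟩
      have hsk := mem_altS.1 Ω.1.2
      have hΩ : ∀ j, (I j)ᵀ * Ω.1.1 * T j - (T j)ᵀ * Ω.1.1 * I j = 0 :=
        fun j => congrArg Subtype.val (congrFun Ω.2 j)
      change (∀ x b c, qOf e Ω.1.1 _ = 0) ∧ (∀ y a c, qOf e Ω.1.1 _ = 0) ∧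
        (∀ x a b, qOf e Ω.1.1 _ = 0) ∧ ∀ j x, qOf e Ω.1.1 _ = 0
      simp only [qOf_apply]
      refine ⟨by simp, by simp, fun x _ _ => quad_zero_of_skew _ hsk x, fun j x => ?_⟩
      have hs : ((I j)ᵀ * Ω.1.1 * T j)ᵀ = -((I j)ᵀ * Ω.1.1 * T j) := by
        rw [sub_eq_zero.1 (hΩ j)]
        have h5 := sub_eq_zero.1 (hΩ j)
        simp only [Matrix.transpose_mul, Matrix.transpose_transpose, hsk, Matrix.mul_assoc,
          Matrix.neg_mul, Matrix.mul_neg] at h5 ⊢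
        rw [h5]
      rw [← quad_zero_of_skew _ hs x, ← Matrix.mulVec_mulVec, ← Matrix.mulVec_mulVec,
        Matrix.mulVec_transpose, dotProduct_comm x, ← Matrix.dotProduct_mulVec, dotProduct_comm]
    · rintro ⟨h1, h2, h3, h4⟩
      let X : (Fin h → ℂ) →ₗ[ℂ] E := e.toLinearMap ∘ₗ LinearMap.inl ℂ _ _
      let Y : (Fin h → ℂ) →ₗ[ℂ] E := e.toLinearMap ∘ₗ LinearMap.inr ℂ _ _ ∘ₗ LinearMap.inl ℂ _ _
      have hX : ∀ x, X x = e (x, 0, 0, 0, 0) := fun _ => rfl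
      have hY : ∀ x, Y x = e (0, x, 0, 0, 0) := fun _ => rfl
      let Ω := LinearMap.toMatrix₂' ℂ (q.polarBilin.compl₁₂ X Y)
      have hΩ : ∀ x y, x ⬝ᵥ Ω *ᵥ y = QuadraticMap.polar q (e (x, 0, 0, 0, 0)) (e (0, y, 0, 0, 0)) := by
        intro x y
        rw [← Matrix.toLinearMap₂'_apply', Matrix.toLinearMap₂'_toMatrix']
        rfl
      have hq : ∀ x y a b c, q (e (x, y, a, b, c)) = x ⬝ᵥ Ω *ᵥ y := by
        intro x y a b c
        rw [hΩ]
        have qadd : ∀ u w, q (u + w) = q u + q w + QuadraticMap.polar q u w :=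
          fun u w => QuadraticMap.map_add q u w
        have d1 : e (x, y, a, b, c) = e (x, 0, 0, b, c) + e (0, y, a, 0, 0) := by
          rw [← map_add]; simp
        have d2 : e (x, 0, 0, b, c) = e (x, 0, 0, 0, 0) + e (0, 0, 0, b, c) := by
          rw [← map_add]; simp
        have d3 : e (0, y, a, 0, 0) = e (0, y, 0, 0, 0) + e (0, 0, a, 0, 0) := by
          rw [← map_add]; simp
        have d4 : e (0, 0, 0, b, c) = e (0, 0, 0, b, 0) + e (0, 0, 0, 0, c) := by
          rw [← map_add]; simp
        have p1 : QuadraticMap.polar q (e (x, 0, 0, 0, 0)) (e (0, 0, a, 0, 0)) = 0 := by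
          have t1 : QuadraticMap.polar q (e (x, x, 0, 0, 0)) (e (0, 0, a, 0, 0)) = 0 := by
            apply polar_zero
            · exact h3 _ _ _
            · exact h2 _ _ _
            · rw [← map_add]; simpa using h3 x a 0
          have t2 : QuadraticMap.polar q (e (0, x, 0, 0, 0)) (e (0, 0, a, 0, 0)) = 0 := by
            apply polar_zero
            · exact h2 _ _ _
            · exact h2 _ _ _
            · rw [← map_add]; simpa using h2 x a 0
          have t3 : e (x, x, 0, 0, 0) = e (x, 0, 0, 0, 0) + e (0, x, 0, 0, 0) := by
            rw [← map_add]; simp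
          rw [t3, QuadraticMap.polar_add_left, t2, add_zero] at t1
          exact t1
        have p2 : QuadraticMap.polar q (e (0, 0, 0, b, 0)) (e (0, y, 0, 0, 0)) = 0 := by
          have t1 : QuadraticMap.polar q (e (0, 0, 0, b, 0)) (e (y, y, 0, 0, 0)) = 0 := by
            apply polar_zero
            · exact h1 _ _ _
            · exact h3 _ _ _
            · rw [← map_add]; simpa using h3 y 0 b
          have t2 : QuadraticMap.polar q (e (0, 0, 0, b, 0)) (e (y, 0, 0, 0, 0)) = 0 := by
            apply polar_zero
            · exact h1 _ _ _
            · exact h1 _ _ _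
            · rw [← map_add]; simpa using h1 y b 0
          have t3 : e (y, y, 0, 0, 0) = e (y, 0, 0, 0, 0) + e (0, y, 0, 0, 0) := by
            rw [← map_add]; simp
          rw [t3, QuadraticMap.polar_add_right, t2, zero_add] at t1
          exact t1
        have p3 : QuadraticMap.polar q (e (0, 0, 0, b, 0)) (e (0, 0, a, 0, 0)) = 0 := by
          apply polar_zero
          · exact h1 _ _ _
          · exact h2 _ _ _
          · rw [← map_add]; simpa using h3 0 a b
        have p4 : QuadraticMap.polar q (e (0, 0, 0, 0, c)) (e (0, y, 0, 0, 0)) = 0 := by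
          apply polar_zero
          · exact h1 _ _ _
          · exact h2 _ _ _
          · rw [← map_add]; simpa using h2 y 0 c
        have p5 : QuadraticMap.polar q (e (0, 0, 0, 0, c)) (e (0, 0, a, 0, 0)) = 0 := by
          apply polar_zero
          · exact h1 _ _ _
          · exact h2 _ _ _
          · rw [← map_add]; simpa using h2 0 a c
        rw [d1, qadd, h1, h2, d2, d3, d4]
        simp only [QuadraticMap.polar_add_left, QuadraticMap.polar_add_right, p1, p2, p3, p4, p5,
          add_zero, zero_add]
      have hsk : Ωᵀ = -Ω := skew_of_quad_zero _ fun x => by rw [← hq x x 0 0 0]; exact h3 _ _ _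
      have hA : ∀ j, (I j)ᵀ * Ω * T j - (T j)ᵀ * Ω * I j = 0 := by
        intro j
        have hs : ((I j)ᵀ * Ω * T j)ᵀ = -((I j)ᵀ * Ω * T j) := by
          refine skew_of_quad_zero _ fun x => ?_
          rw [← h4 j x, hq, ← Matrix.mulVec_mulVec, ← Matrix.mulVec_mulVec,
            Matrix.mulVec_transpose, dotProduct_comm x, ← Matrix.dotProduct_mulVec, dotProduct_comm]
        simp only [Matrix.transpose_mul, Matrix.transpose_transpose, hsk, Matrix.mul_assoc,
          Matrix.neg_mul, Matrix.mul_neg, neg_inj] at hs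
        rw [Matrix.mul_assoc, Matrix.mul_assoc, hs, sub_self]
      refine ⟨⟨⟨Ω, hsk⟩, funext fun j => Subtype.ext (hA j)⟩, ?_⟩
      ext v
      obtain ⟨⟨x, y, a, b, c⟩, rfl⟩ := e.surjective v
      rw [hq]
      exact qOf_apply e Ω _
  rw [← hr]
  exact LinearMap.finrank_range_of_inj (qLin_inj e I T)

end Part5

section Part6

open Matrix

theorem sum_Icc_split (f : ℕ → ℤ) (t : ℕ) :
    ∑ i ∈ Finset.Icc 1 (t + 3), f i = f 1 + f 2 + f 3 + ∑ j : Fin t, f (j.1 + 4) := by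
  induction t with
  | zero =>
    rw [show (0 + 3) = 2 + 1 from rfl, Finset.sum_Icc_succ_top (by omega),
      Finset.sum_Icc_succ_top (by omega)]
    simp
  | succ k ih =>
    rw [show k + 1 + 3 = (k + 3) + 1 by omega, Finset.sum_Icc_succ_top (by omega), ih,
      Fin.sum_univ_castSucc]
    simp only [Fin.val_castSucc, Fin.val_last]
    rw [show k + 3 + 1 = k + 4 by omega]
    ring

theorem two_choose (k : ℕ) : (2 : ℤ) * ((k + 1).choose 2 : ℤ) = (k + 1) * k := by
  have h1 := Nat.triangle_succ k
  rw [Nat.choose_two_right]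
  have h5 : (k + 1) * (k + 1 - 1) / 2 * 2 = (k + 1) * (k + 1 - 1) :=
    Nat.div_mul_cancel (Nat.even_mul_pred_self (k + 1)).two_dvd
  simp only [Nat.add_sub_cancel] at h5 ⊢
  have h6 : (((k + 1) * k / 2 : ℕ) : ℤ) * 2 = (k + 1) * k := by exact_mod_cast h5
  linear_combination h6

theorem choose_arith (k a b c : ℕ) :
    ((2 * (k + 1) + a + b + c + 1).choose 2 : ℤ) - (((k + 1) + b + c + 1).choose 2 : ℤ)
      - (((k + 1) + a + c + 1).choose 2 : ℤ) - (((k + 1) + a + b + 1).choose 2 : ℤ)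
      + ((c + 1).choose 2 : ℤ) + ((b + 1).choose 2 : ℤ) + ((a + 1).choose 2 : ℤ)
      = ((k + 1).choose 2 : ℤ) := by
  have e1 := two_choose (2 * (k + 1) + a + b + c)
  have e2 := two_choose ((k + 1) + b + c)
  have e3 := two_choose ((k + 1) + a + c)
  have e4 := two_choose ((k + 1) + a + b)
  have e5 := two_choose c
  have e6 := two_choose b
  have e7 := two_choose a
  have e8 := two_choose k
  have : (2 : ℤ) ≠ 0 := by norm_num
  apply mul_left_cancel₀ this
  push_cast at *
  linear_combination e1 - e2 - e3 - e4 + e5 + e6 + e7 - e8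

variable (U P Q R : Type) [AddCommGroup U] [Module ℂ U]
  [AddCommGroup P] [Module ℂ P] [AddCommGroup Q] [Module ℂ Q] [AddCommGroup R] [Module ℂ R]

/-- First model subspace. -/
def mapOne : (U × Q × R) →ₗ[ℂ] (U × U × P × Q × R) where
  toFun p := (p.1, 0, 0, p.2.1, p.2.2)
  map_add' p q := by simp; rfl
  map_smul' c p := by simp; rfl

/-- Second model subspace. -/
def mapTwo : (U × P × R) →ₗ[ℂ] (U × U × P × Q × R) where
  toFun p := (0, p.1, p.2.1, 0, p.2.2)
  map_add' p q := by simp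
  map_smul' c p := by simp

/-- Third model subspace. -/
def mapThree : (U × P × Q) →ₗ[ℂ] (U × U × P × Q × R) where
  toFun p := (p.1, p.1, p.2.1, p.2.2, 0)
  map_add' p q := by simp
  map_smul' c p := by simp

/-- Inclusion of the pairs. -/
def mapPair : (U × U) →ₗ[ℂ] (U × U × P × Q × R) where
  toFun p := (p.1, p.2, 0, 0, 0)
  map_add' p q := by simp
  map_smul' c p := by simp

theorem mapOne_inj : Function.Injective (mapOne U P Q R) := by
  rintro ⟨x, b, c⟩ ⟨x', b', c'⟩ hh
  simp [mapOne] at hh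
  simp [hh]

theorem mapTwo_inj : Function.Injective (mapTwo U P Q R) := by
  rintro ⟨x, b, c⟩ ⟨x', b', c'⟩ hh
  simp [mapTwo] at hh
  simp [hh]

theorem mapThree_inj : Function.Injective (mapThree U P Q R) := by
  rintro ⟨x, b, c⟩ ⟨x', b', c'⟩ hh
  simp [mapThree] at hh
  simp [hh]

theorem mapPair_inj : Function.Injective (mapPair U P Q R) := by
  rintro ⟨x, b⟩ ⟨x', b'⟩ hh
  simp [mapPair] at hh
  simp [hh]

end Part6

open Matrix in
theorem main_aux (n t k a b c : ℕ) (m : ℕ → ℕ) (hn : n + 1 = 2 * (k + 1) + a + b + c)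
    (hm1 : m 1 + 1 = (k + 1) + b + c) (hm2 : m 2 + 1 = (k + 1) + a + c)
    (hm3 : m 3 + 1 = (k + 1) + a + b) (hmj : ∀ j : Fin t, m (j.1 + 4) + 1 ≤ 2 * (k + 1)) :
    ∃ W : ℕ → Submodule ℂ (Fin (n + 1) → ℂ),
      (∀ i ∈ Finset.Icc 1 (t + 3), Module.finrank ℂ (W i) = m i + 1) ∧
      (Module.finrank ℂ (quadVanishing n (t + 3) W) : ℤ) =
        max (((k + 1).choose 2 : ℤ) - ∑ j : Fin t, ((m (j.1 + 4) + 1 + 1).choose 2 : ℤ)) 0 := by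
  classical
  obtain ⟨I, T, hgen⟩ := exists_diffGen (Fin t) (k + 1) (fun j => m (j.1 + 4) + 1)
  have hfr : Module.finrank ℂ ((Fin (k + 1) → ℂ) × (Fin (k + 1) → ℂ) × (Fin a → ℂ) × (Fin b → ℂ) ×
      (Fin c → ℂ)) = Module.finrank ℂ (Fin (n + 1) → ℂ) := by
    simp only [Module.finrank_prod, Module.finrank_fin_fun]
    omega
  let e := LinearEquiv.ofFinrankEq _ _ hfr
  let g : ∀ j : Fin t, (Fin (m (j.1 + 4) + 1) → ℂ) →ₗ[ℂ] (Fin (n + 1) → ℂ) := fun j =>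
    e.toLinearMap ∘ₗ mapPair _ _ _ _ ∘ₗ ((I j).mulVecLin.prod (T j).mulVecLin)
  have hg : ∀ j, Function.Injective (g j) := by
    intro j
    refine e.injective.comp ((mapPair_inj _ _ _ _).comp ?_)
    rw [← LinearMap.ker_eq_bot, Submodule.eq_bot_iff]
    intro x hx
    have h1 : (I j *ᵥ x, T j *ᵥ x) = 0 := hx
    rw [Prod.mk_eq_zero] at h1
    have h2 : x ∈ subY I T ⊥ j := ⟨h1.1, h1.2⟩
    rw [joint_inj I T hgen hmj j] at h2
    exact (Submodule.mem_bot ℂ).1 h2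
  let f1 := e.toLinearMap ∘ₗ mapOne (Fin (k + 1) → ℂ) (Fin a → ℂ) (Fin b → ℂ) (Fin c → ℂ)
  let f2 := e.toLinearMap ∘ₗ mapTwo (Fin (k + 1) → ℂ) (Fin a → ℂ) (Fin b → ℂ) (Fin c → ℂ)
  let f3 := e.toLinearMap ∘ₗ mapThree (Fin (k + 1) → ℂ) (Fin a → ℂ) (Fin b → ℂ) (Fin c → ℂ)
  let W : ℕ → Submodule ℂ (Fin (n + 1) → ℂ) := fun i =>
    if i = 1 then LinearMap.range f1 else if i = 2 then LinearMap.range f2 else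
    if i = 3 then LinearMap.range f3 else
    if hi : i - 4 < t then LinearMap.range (g ⟨i - 4, hi⟩) else ⊥
  have w1 : W 1 = LinearMap.range f1 := by simp [W]
  have w2 : W 2 = LinearMap.range f2 := by simp [W]
  have w3 : W 3 = LinearMap.range f3 := by simp [W]
  have w4 : ∀ j : Fin t, W (j.1 + 4) = LinearMap.range (g j) := by
    intro j
    simp only [W]
    rw [if_neg (by omega), if_neg (by omega), if_neg (by omega)]
    have hj : j.1 + 4 - 4 < t := by have := j.2; omega
    have hj2 : (⟨j.1 + 4 - 4, hj⟩ : Fin t) = j := Fin.ext (by simp)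
    rw [dif_pos hj]
    exact congrArg (fun i => LinearMap.range (g i)) hj2
  have hcases : ∀ p : ℕ → Prop, (∀ i ∈ Finset.Icc 1 (t + 3), p i) ↔
      (p 1 ∧ p 2 ∧ p 3 ∧ ∀ j : Fin t, p (j.1 + 4)) := by
    intro p
    constructor
    · intro hp
      refine ⟨hp _ ?_, hp _ ?_, hp _ ?_, fun j => hp _ ?_⟩ <;>
        simp only [Finset.mem_Icc] <;> omega
    · rintro ⟨p1, p2, p3, p4⟩ i hi
      rw [Finset.mem_Icc] at hi
      by_cases h4 : 4 ≤ i
      · have := p4 ⟨i - 4, by omega⟩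
        simpa [Nat.sub_add_cancel h4] using this
      · have : i = 1 ∨ i = 2 ∨ i = 3 := by omega
        rcases this with rfl | rfl | rfl <;> assumption
  refine ⟨W, ?_, ?_⟩
  · rw [hcases]
    refine ⟨?_, ?_, ?_, fun j => ?_⟩
    · rw [w1, LinearMap.finrank_range_of_inj (f := f1) (e.injective.comp (mapOne_inj _ _ _ _))]
      simp only [Module.finrank_prod, Module.finrank_fin_fun]
      omega
    · rw [w2, LinearMap.finrank_range_of_inj (f := f2) (e.injective.comp (mapTwo_inj _ _ _ _))]
      simp only [Module.finrank_prod, Module.finrank_fin_fun]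
      omega
    · rw [w3, LinearMap.finrank_range_of_inj (f := f3) (e.injective.comp (mapThree_inj _ _ _ _))]
      simp only [Module.finrank_prod, Module.finrank_fin_fun]
      omega
    · rw [w4, LinearMap.finrank_range_of_inj (hg j), Module.finrank_fin_fun]
  · rw [core e I T (quadVanishing n (t + 3) W) ?_, Astar_ker I T hgen hmj]
    intro q
    change (∀ i ∈ Finset.Icc 1 (t + 3), ∀ x ∈ W i, q x = 0) ↔ _
    rw [hcases]
    rw [w1, w2, w3]
    simp only [w4]
    refine and_congr ?_ (and_congr ?_ (and_congr ?_ (forall_congr' fun j => ?_)))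
    · exact ⟨fun hh x b c => hh _ ⟨(x, b, c), rfl⟩, by rintro hh _ ⟨⟨x, b, c⟩, rfl⟩; exact hh x b c⟩
    · exact ⟨fun hh x b c => hh _ ⟨(x, b, c), rfl⟩, by rintro hh _ ⟨⟨x, b, c⟩, rfl⟩; exact hh x b c⟩
    · exact ⟨fun hh x b c => hh _ ⟨(x, b, c), rfl⟩, by rintro hh _ ⟨⟨x, b, c⟩, rfl⟩; exact hh x b c⟩
    · exact ⟨fun hh x => hh _ ⟨x, rfl⟩, by rintro hh _ ⟨x, rfl⟩; exact hh x⟩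

/-- Intersecting case (ii)(c): if `2m_1 - n + 2 ≤ v ≤ m_1`, `τ = 3`, and either
(`s ≥ 4` and `2n ≥ m_1 + m_2 + m_3 + m_4 + 2`) or `s = 3`, then for a generic configuration
of linear spaces of weight vector `(m_1, …, m_s)` one has
`dim (I_Λ)_2 = max { C(n+2,2) - Σ_{i=1}^s C(m_i+2,2) + Σ_{1≤i<j≤3} C(m_i+m_j-n+2,2), 0 }`.
Here `τ = max{ i ≤ s : m_1 + m_i ≥ n }` and `v = Σ_{i=2}^{τ} (m_1 + m_i - n + 1)`.
(`m` is 1-indexed; `C(a,2) = 0` for `a < 2`, which agrees with truncated subtraction.) -/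
theorem stmt8 (n s : ℕ) (m : ℕ → ℕ) (hs : 2 ≤ s)
    (hmono : ∀ i j, 1 ≤ i → i ≤ j → j ≤ s → m j ≤ m i)
    (h12 : n ≤ m 1 + m 2)
    (τ v : ℕ)
    (hτ : τ = Nat.findGreatest (fun i => n ≤ m 1 + m i) s)
    (hv : v = ∑ i ∈ Finset.Icc 2 τ, (m 1 + m i + 1 - n))
    (hlow : 2 * m 1 + 2 ≤ v + n) (hhigh : v ≤ m 1)
    (hτ3 : τ = 3)
    (hcase : (4 ≤ s ∧ m 1 + m 2 + m 3 + m 4 + 2 ≤ 2 * n) ∨ s = 3) :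
    ∃ W : ℕ → Submodule ℂ (Fin (n + 1) → ℂ),
      (∀ i ∈ Finset.Icc 1 s, Module.finrank ℂ (W i) = m i + 1) ∧
      (Module.finrank ℂ (quadVanishing n s W) : ℤ) =
        max (((n + 2).choose 2 : ℤ)
              - ∑ i ∈ Finset.Icc 1 s, ((m i + 2).choose 2 : ℤ)
              + (((m 1 + m 2 + 2 - n).choose 2 : ℤ)
                  + ((m 1 + m 3 + 2 - n).choose 2 : ℤ)
                  + ((m 2 + m 3 + 2 - n).choose 2 : ℤ))) 0 := by
  subst hτ3
  have hs3 : 3 ≤ s := by rw [hτ]; exact Nat.findGreatest_le s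
  have h13 : n ≤ m 1 + m 3 := by
    exact Nat.findGreatest_of_ne_zero (P := fun i => n ≤ m 1 + m i) hτ.symm (by norm_num)
  have hv2 : v = (m 1 + m 2 + 1 - n) + (m 1 + m 3 + 1 - n) := by
    rw [hv, show (3 : ℕ) = 2 + 1 from rfl, Finset.sum_Icc_succ_top (by omega)]
    simp
  obtain ⟨t, rfl⟩ : ∃ t, s = t + 3 := ⟨s - 3, by omega⟩
  obtain ⟨k, hk⟩ : ∃ k, 2 * n = m 1 + m 2 + m 3 + 2 + k :=
    ⟨2 * n - (m 1 + m 2 + m 3 + 2), by omega⟩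
  obtain ⟨a, ha⟩ : ∃ a, m 2 + m 3 + 1 = n + a := ⟨m 2 + m 3 + 1 - n, by omega⟩
  obtain ⟨b, hb⟩ : ∃ b, m 1 + m 3 + 1 = n + b := ⟨m 1 + m 3 + 1 - n, by omega⟩
  obtain ⟨c, hc⟩ : ∃ c, m 1 + m 2 + 1 = n + c := ⟨m 1 + m 2 + 1 - n, by omega⟩
  have hm1 : m 1 + 1 = (k + 1) + b + c := by omega
  have hm2 : m 2 + 1 = (k + 1) + a + c := by omega
  have hm3 : m 3 + 1 = (k + 1) + a + b := by omega
  have hn : n + 1 = 2 * (k + 1) + a + b + c := by omega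
  have hmj : ∀ j : Fin t, m (j.1 + 4) + 1 ≤ 2 * (k + 1) := by
    intro j
    have hj := j.2
    have h1 := hmono 4 (j.1 + 4) (by omega) (by omega) (by omega)
    rcases hcase with hcase | hcase <;> omega
  obtain ⟨W, hW1, hW2⟩ := main_aux n t k a b c m hn hm1 hm2 hm3 hmj
  refine ⟨W, hW1, ?_⟩
  rw [hW2, sum_Icc_split (fun i => ((m i + 2).choose 2 : ℤ))]
  have e := choose_arith k a b c
  rw [show n + 2 = 2 * (k + 1) + a + b + c + 1 by omega,
    show m 1 + m 2 + 2 - n = c + 1 by omega, show m 1 + m 3 + 2 - n = b + 1 by omega,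
    show m 2 + m 3 + 2 - n = a + 1 by omega]
  beta_reduce
  rw [show m 1 + 2 = (k + 1) + b + c + 1 by omega, show m 2 + 2 = (k + 1) + a + c + 1 by omega,
    show m 3 + 2 = (k + 1) + a + b + 1 by omega]
  congr 1
  rw [← e]
  ring
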